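/- arXiv:1702.06237 — 4 statements merged into one kernel-verified Lean document; each statement's English description precedes it below -/
import Mathlib

section
/- Let {u_i}_{i=1}^r ⊂ ℝ^{n₁}, {v_i}_{i=1}^r ⊂ ℝ^{n₂}, {w_i}_{i=1}^r ⊂ ℝ^{n₃} be orthonormal sets with all vectors μ-incoherent (so u_{ia}² ≤ μ/n₁, v_{ib}² ≤ μ/n₂, w_{ic}² ≤ μ/n₃ for all entries), and let X = Σ_{i=1}^r u_i ⊗ v_i ⊗ w_i. Then: (1) max_{a,b,c} X²_{abc} ≤ r²μ³/(n₁n₂n₃); (2) for all b,c: Σ_a X²_{abc} ≤ rμ²/(n₂n₃), for all a,c: Σ_b X²_{abc} ≤ rμ²/(n₁n₃), and for all a,b: Σ_c X²_{abc} ≤ rμ²/(n₁n₂); (3) for all c: Σ_{a,b} X²_{abc} ≤ rμ/n₃, for all b: Σ_{a,c} X²_{abc} ≤ rμ/n₂, and for all a: Σ_{b,c} X²_{abc} ≤ rμ/n₁; (4) Σ_{a,b,c} X²_{abc} = r. Equivalently, X is (rμ³/(n₁n₂n₃), r, μ)-bounded. -/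
open scoped BigOperators

lemma aux_pars {n r : ℕ} (u : Fin r → Fin n → ℝ)
    (hu : ∀ i j, (∑ a, u i a * u j a) = if i = j then (1 : ℝ) else 0) (s : Fin r → ℝ) :
    ∑ a, (∑ i, u i a * s i) ^ 2 = ∑ i, (s i) ^ 2 := by
  have h1 : ∀ a, (∑ i, u i a * s i) ^ 2 = ∑ i, ∑ j, s i * s j * (u i a * u j a) := by
    intro a
    rw [sq, Finset.sum_mul_sum]
    refine Finset.sum_congr rfl fun i _ => Finset.sum_congr rfl fun j _ => by ring
  simp_rw [h1]
  rw [Finset.sum_comm]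
  refine Finset.sum_congr rfl fun i _ => ?_
  rw [Finset.sum_comm]
  simp_rw [← Finset.mul_sum, hu]
  simp [sq]

lemma aux_norm {n r : ℕ} (u : Fin r → Fin n → ℝ)
    (hu : ∀ i j, (∑ a, u i a * u j a) = if i = j then (1 : ℝ) else 0) (s : Fin r → ℝ) :
    ∑ a, ∑ i, (u i a * s i) ^ 2 = ∑ i, (s i) ^ 2 := by
  rw [Finset.sum_comm]
  refine Finset.sum_congr rfl fun i _ => ?_
  have := hu i i
  simp only [if_true, ← sq] at this
  simp_rw [mul_pow]
  rw [← Finset.sum_mul, this, one_mul]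

lemma aux_le {r : ℕ} (f : Fin r → ℝ) (C : ℝ) (h : ∀ i, f i ≤ C) : ∑ i, f i ≤ r * C := by
  have := Finset.sum_le_sum (fun i (_ : i ∈ Finset.univ) => h i)
  simpa using this

lemma aux_mul {x y A B : ℝ} (hx : x ^ 2 ≤ A) (hy : y ^ 2 ≤ B) : (x * y) ^ 2 ≤ A * B := by
  rw [mul_pow]
  exact mul_le_mul hx hy (sq_nonneg _) ((sq_nonneg _).trans hx)

theorem stmt_9 (n₁ n₂ n₃ r : ℕ) (μ : ℝ)
    (u : Fin r → Fin n₁ → ℝ) (v : Fin r → Fin n₂ → ℝ) (w : Fin r → Fin n₃ → ℝ)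
    (hu : ∀ i j, (∑ a, u i a * u j a) = if i = j then (1 : ℝ) else 0)
    (hv : ∀ i j, (∑ b, v i b * v j b) = if i = j then (1 : ℝ) else 0)
    (hw : ∀ i j, (∑ c, w i c * w j c) = if i = j then (1 : ℝ) else 0)
    (huinc : ∀ i a, (u i a) ^ 2 ≤ μ / n₁)
    (hvinc : ∀ i b, (v i b) ^ 2 ≤ μ / n₂)
    (hwinc : ∀ i c, (w i c) ^ 2 ≤ μ / n₃)
    (X : Fin n₁ → Fin n₂ → Fin n₃ → ℝ)
    (hX : ∀ a b c, X a b c = ∑ i, u i a * v i b * w i c) :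
    (∀ a b c, (X a b c) ^ 2 ≤ (r : ℝ) ^ 2 * μ ^ 3 / (n₁ * n₂ * n₃)) ∧
    (∀ b c, (∑ a, (X a b c) ^ 2) ≤ (r : ℝ) * μ ^ 2 / (n₂ * n₃)) ∧
    (∀ a c, (∑ b, (X a b c) ^ 2) ≤ (r : ℝ) * μ ^ 2 / (n₁ * n₃)) ∧
    (∀ a b, (∑ c, (X a b c) ^ 2) ≤ (r : ℝ) * μ ^ 2 / (n₁ * n₂)) ∧
    (∀ c, (∑ a, ∑ b, (X a b c) ^ 2) ≤ (r : ℝ) * μ / n₃) ∧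
    (∀ b, (∑ a, ∑ c, (X a b c) ^ 2) ≤ (r : ℝ) * μ / n₂) ∧
    (∀ a, (∑ b, ∑ c, (X a b c) ^ 2) ≤ (r : ℝ) * μ / n₁) ∧
    (∑ a, ∑ b, ∑ c, (X a b c) ^ 2) = (r : ℝ) := by
  have ea : ∀ b c, ∑ a, (X a b c) ^ 2 = ∑ i, (v i b * w i c) ^ 2 := by
    intro b c
    rw [← aux_pars u hu]
    simp only [hX, mul_assoc]
  have eb : ∀ a c, ∑ b, (X a b c) ^ 2 = ∑ i, (u i a * w i c) ^ 2 := by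
    intro a c
    rw [← aux_pars v hv]
    refine Finset.sum_congr rfl fun b _ => ?_
    rw [hX]
    congr 1
    exact Finset.sum_congr rfl fun i _ => by ring
  have ec : ∀ a b, ∑ c, (X a b c) ^ 2 = ∑ i, (u i a * v i b) ^ 2 := by
    intro a b
    rw [← aux_pars w hw]
    refine Finset.sum_congr rfl fun c _ => ?_
    rw [hX]
    congr 1
    exact Finset.sum_congr rfl fun i _ => by ring
  have eab : ∀ c, ∑ a, ∑ b, (X a b c) ^ 2 = ∑ i, (w i c) ^ 2 := by
    intro c
    simp_rw [eb]
    exact aux_norm u hu _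
  have eac : ∀ b, ∑ a, ∑ c, (X a b c) ^ 2 = ∑ i, (v i b) ^ 2 := by
    intro b
    simp_rw [ec]
    exact aux_norm u hu _
  have ebc : ∀ a, ∑ b, ∑ c, (X a b c) ^ 2 = ∑ i, (u i a) ^ 2 := by
    intro a
    simp_rw [ec, mul_comm (u _ a)]
    exact aux_norm v hv _
  refine ⟨fun a b c => ?_, fun b c => ?_, fun a c => ?_, fun a b => ?_, fun c => ?_,
    fun b => ?_, fun a => ?_, ?_⟩
  · rw [hX]
    have h1 := sq_sum_le_card_mul_sum_sq (s := Finset.univ) (f := fun i => u i a * v i b * w i c)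
    have h2 := aux_le (fun i => (u i a * v i b * w i c) ^ 2) _
      (fun i => aux_mul (aux_mul (huinc i a) (hvinc i b)) (hwinc i c))
    rw [Finset.card_univ, Fintype.card_fin] at h1
    refine (h1.trans (mul_le_mul_of_nonneg_left h2 (Nat.cast_nonneg r))).trans (le_of_eq ?_)
    simp only [div_eq_mul_inv, mul_inv]
    ring
  · rw [ea]
    refine (aux_le _ _ (fun i => aux_mul (hvinc i b) (hwinc i c))).trans (le_of_eq ?_)
    simp only [div_eq_mul_inv, mul_inv]
    ring
  · rw [eb]
    refine (aux_le _ _ (fun i => aux_mul (huinc i a) (hwinc i c))).trans (le_of_eq ?_)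
    simp only [div_eq_mul_inv, mul_inv]
    ring
  · rw [ec]
    refine (aux_le _ _ (fun i => aux_mul (huinc i a) (hvinc i b))).trans (le_of_eq ?_)
    simp only [div_eq_mul_inv, mul_inv]
    ring
  · rw [eab, mul_div_assoc]
    exact aux_le _ _ (fun i => hwinc i c)
  · rw [eac, mul_div_assoc]
    exact aux_le _ _ (fun i => hvinc i b)
  · rw [ebc, mul_div_assoc]
    exact aux_le _ _ (fun i => huinc i a)
  · simp_rw [ebc]
    have := aux_norm u hu (fun _ => 1)
    simpa using this
end

section
/- Let p ≥ 1, r ≥ 0, n > 1, and B > 0 be reals, and let Y be a random real matrix. If E[tr((YYᵀ)^q)] ≤ (q^p·B)^{2q}·n^r for all integers q ≥ 1, then for all β > 0: Pr[‖Y‖ > B·e^p·((r+β)/(2p)·ln n + 1)^p] < n^{−β}, where ‖Y‖ denotes the spectral norm. -/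
open scoped BigOperators
open MeasureTheory Matrix

/-- The spectral (operator) norm of a real matrix. -/
noncomputable def specNorm {m n : Type*} [Fintype m] [Fintype n] [DecidableEq n]
    (M : Matrix m n ℝ) : ℝ :=
  ‖LinearMap.toContinuousLinearMap (Matrix.toEuclideanLin M)‖

section
open scoped Matrix.Norms.L2Operator

lemma aux_trace {d : ℕ} (A : Matrix (Fin d) (Fin d) ℝ) (hA : A.PosSemidef) (q : ℕ) (hq : 1 ≤ q) :
    ‖A‖ ^ q ≤ (A ^ q).trace := by
  have hH := hA.isHermitian
  have h0 := hA.eigenvalues_nonneg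
  have hnorm : ‖A‖ = ‖hH.eigenvalues‖ := by
    conv_lhs => rw [hH.spectral_theorem, Unitary.conjStarAlgAut_apply, ← Unitary.coe_star,
      CStarRing.norm_mul_coe_unitary, CStarRing.norm_coe_unitary_mul, l2_opNorm_diagonal]
    rfl
  have htr : (A ^ q).trace = ∑ i, hH.eigenvalues i ^ q := by
    conv_lhs => rw [hH.spectral_theorem, ← map_pow, Unitary.conjStarAlgAut_apply,
      Matrix.trace_mul_comm, ← mul_assoc, Unitary.coe_star_mul_self, one_mul,
      Matrix.diagonal_pow, Matrix.trace_diagonal]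
    rfl
  rw [hnorm, htr]
  rcases isEmpty_or_nonempty (Fin d) with h | h
  · simp [Pi.norm_def, Nat.one_le_iff_ne_zero.mp hq]
  · obtain ⟨i, hi⟩ := Finite.exists_max hH.eigenvalues
    have : ‖hH.eigenvalues‖ ≤ hH.eigenvalues i := by
      rw [pi_norm_le_iff_of_nonneg (h0 i)]
      intro j
      rw [Real.norm_of_nonneg (h0 j)]
      exact hi j
    calc _ ≤ hH.eigenvalues i ^ q := by gcongr
      _ ≤ _ := Finset.single_le_sum (f := fun i => hH.eigenvalues i ^ q)
        (fun j _ => pow_nonneg (h0 j) q) (Finset.mem_univ i)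

lemma aux_spec {d₁ d₂ : ℕ} (Y : Matrix (Fin d₁) (Fin d₂) ℝ) (q : ℕ) (hq : 1 ≤ q) :
    specNorm Y ^ (2 * q) ≤ ((Y * Yᵀ) ^ q).trace := by
  have hps : (Y * Yᵀ).PosSemidef := by
    simpa using Matrix.posSemidef_self_mul_conjTranspose Y
  refine le_trans (le_of_eq ?_) (aux_trace _ hps q hq)
  have h1 : specNorm Y = ‖Y‖ := rfl
  have h2 := l2_opNorm_conjTranspose_mul_self Yᴴ
  rw [conjTranspose_conjTranspose, l2_opNorm_conjTranspose, conjTranspose_eq_transpose_of_trivial] at h2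
  rw [h2, h1, pow_mul, sq]

end

theorem stmt_11 {Θ : Type*} [MeasurableSpace Θ] (P : Measure Θ) [IsProbabilityMeasure P]
    (d₁ d₂ : ℕ) (Y : Θ → Matrix (Fin d₁) (Fin d₂) ℝ)
    (hmeas : ∀ i j, Measurable fun θ => Y θ i j)
    (p r n B : ℝ) (hp : 1 ≤ p) (hr : 0 ≤ r) (hn : 1 < n) (hB : 0 < B)
    (hint : ∀ q : ℕ, 1 ≤ q → Integrable (fun θ => ((Y θ * (Y θ)ᵀ) ^ q).trace) P)
    (hE : ∀ q : ℕ, 1 ≤ q →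
      (∫ θ, ((Y θ * (Y θ)ᵀ) ^ q).trace ∂P) ≤ ((q : ℝ) ^ p * B) ^ (2 * q) * n ^ r)
    (β : ℝ) (hβ : 0 < β) :
    P {θ | B * Real.exp p * ((r + β) / (2 * p) * Real.log n + 1) ^ p < specNorm (Y θ)}
      < ENNReal.ofReal (n ^ (-β)) := by
  have hlog : 0 < Real.log n := Real.log_pos hn
  have hp0 : 0 < p := by linarith
  set x : ℝ := (r + β) / (2 * p) * Real.log n with hx
  have hx0 : 0 < x := by positivity
  set T : ℝ := B * Real.exp p * (x + 1) ^ p with hT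
  have hT0 : 0 < T := by positivity
  obtain ⟨q, hqdef⟩ : ∃ q, q = ⌈x⌉₊ := ⟨_, rfl⟩
  have hq : 1 ≤ q := by rw [hqdef]; exact Nat.one_le_ceil_iff.mpr hx0
  have hxq : x ≤ q := by rw [hqdef]; exact Nat.le_ceil x
  have hqx : (q : ℝ) < x + 1 := by rw [hqdef]; exact Nat.ceil_lt_add_one hx0.le
  have hc0 : 0 < T ^ (2 * q) := by positivity
  have hmark := mul_meas_ge_le_integral_of_nonneg (μ := P)
    (f := fun θ => ((Y θ * (Y θ)ᵀ) ^ q).trace)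
    (Filter.Eventually.of_forall fun θ =>
      le_trans (pow_nonneg (norm_nonneg _) _) (aux_spec (Y θ) q hq)) (hint q hq) (T ^ (2 * q))
  have hsub : {θ | T < specNorm (Y θ)} ⊆ {θ | T ^ (2 * q) ≤ ((Y θ * (Y θ)ᵀ) ^ q).trace} := by
    intro θ hθ
    exact le_trans (pow_le_pow_left₀ hT0.le (le_of_lt hθ) _) (aux_spec (Y θ) q hq)
  have key : ((q : ℝ) ^ p * B) ^ (2 * q) * n ^ r < T ^ (2 * q) * n ^ (-β) := by
    have hn0 : 0 < n := by linarith
    have e1 : Real.exp p ^ (2 * q) = Real.exp (2 * q * p) := by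
      rw [← Real.exp_nat_mul]; push_cast; rfl
    have e2 : n ^ r ≤ Real.exp (2 * q * p) * n ^ (-β) := by
      rw [Real.rpow_def_of_pos hn0, Real.rpow_def_of_pos hn0, ← Real.exp_add]
      apply Real.exp_le_exp.mpr
      have : 2 * p * x = (r + β) * Real.log n := by rw [hx]; field_simp
      nlinarith
    have e3 : T ^ (2 * q) = ((x + 1) ^ p * B) ^ (2 * q) * Real.exp (2 * q * p) := by
      rw [← e1, ← mul_pow, hT]; ring
    have e4 : ((q : ℝ) ^ p * B) ^ (2 * q) < ((x + 1) ^ p * B) ^ (2 * q) := by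
      apply pow_lt_pow_left₀ _ (by positivity) (by omega)
      exact mul_lt_mul_of_pos_right (Real.rpow_lt_rpow (by positivity) hqx hp0) hB
    rw [e3, mul_assoc]
    exact mul_lt_mul e4 e2 (by positivity) (by positivity)
  have hlt := lt_of_mul_lt_mul_left ((hmark.trans (hE q hq)).trans_lt key) hc0.le
  refine lt_of_le_of_lt (measure_mono hsub) ?_
  rw [← ofReal_measureReal]
  exact (ENNReal.ofReal_lt_ofReal_iff (by positivity)).mpr hlt
end

section
/- Let p ≥ 1, r ≥ 0, n > 1, and B > 0 be reals, and let Z be a nonnegative real random variable. If E[Z^q] ≤ (q^p·B)^{2q}·n^r for all integers q ≥ 1, then for all β > 0: Pr[Z > B²·e^{2p}·((r+β)/(2p)·ln n + 1)^{2p}] < n^{−β}. -/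
open scoped BigOperators
open MeasureTheory

theorem stmt_12 {Θ : Type*} [MeasurableSpace Θ] (P : Measure Θ) [IsProbabilityMeasure P]
    (Z : Θ → ℝ) (hmeas : Measurable Z) (hZ : ∀ θ, 0 ≤ Z θ)
    (p r n B : ℝ) (hp : 1 ≤ p) (hr : 0 ≤ r) (hn : 1 < n) (hB : 0 < B)
    (hint : ∀ q : ℕ, 1 ≤ q → Integrable (fun θ => Z θ ^ q) P)
    (hE : ∀ q : ℕ, 1 ≤ q →
      (∫ θ, Z θ ^ q ∂P) ≤ ((q : ℝ) ^ p * B) ^ (2 * q) * n ^ r)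
    (β : ℝ) (hβ : 0 < β) :
    P {θ | B ^ 2 * Real.exp (2 * p) *
        ((r + β) / (2 * p) * Real.log n + 1) ^ (2 * p) < Z θ}
      < ENNReal.ofReal (n ^ (-β)) := by
  have hL : 0 < Real.log n := Real.log_pos hn
  have hn0 : 0 < n := by linarith
  have hp0 : 0 < p := by linarith
  set x : ℝ := (r + β) / (2 * p) * Real.log n with hx
  have hx0 : 0 < x := by positivity
  set q : ℕ := ⌈x⌉₊ with hq
  have hq0 : 0 < q := Nat.ceil_pos.mpr hx0
  have hxq : x ≤ q := Nat.le_ceil x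
  have hqx : (q : ℝ) < x + 1 := Nat.ceil_lt_add_one hx0.le
  set T : ℝ := B ^ 2 * Real.exp (2 * p) * (x + 1) ^ (2 * p) with hT
  have hT0 : 0 < T := by positivity
  have hTq : T ^ q = ((x + 1) ^ p * B) ^ (2 * q) * Real.exp (2 * p * q) := by
    have h1 : (x + 1) ^ (2 * p) = ((x + 1) ^ p) ^ 2 := by
      rw [mul_comm, Real.rpow_mul (by positivity)]
      norm_cast
    have h2 : Real.exp (2 * p * q) = Real.exp (2 * p) ^ q := by
      rw [mul_comm, Real.exp_nat_mul]
    rw [hT, h1, h2, pow_mul, ← mul_pow]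
    congr 1
    ring
  have hexp : n ^ r ≤ Real.exp (2 * p * q) * n ^ (-β) := by
    rw [Real.rpow_def_of_pos hn0, Real.rpow_def_of_pos hn0, ← Real.exp_add]
    apply Real.exp_le_exp.mpr
    have h3 : 2 * p * x = (r + β) * Real.log n := by
      rw [hx]; field_simp
    nlinarith [mul_le_mul_of_nonneg_left hxq (by positivity : 0 ≤ 2 * p)]
  have hlt : ((q : ℝ) ^ p * B) ^ (2 * q) < ((x + 1) ^ p * B) ^ (2 * q) := by
    apply pow_lt_pow_left₀ _ (by positivity) (by omega)
    exact mul_lt_mul_of_pos_right (Real.rpow_lt_rpow (by positivity) hqx hp0) hB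
  have hmain : ((q : ℝ) ^ p * B) ^ (2 * q) * n ^ r < T ^ q * n ^ (-β) := by
    calc _ < ((x + 1) ^ p * B) ^ (2 * q) * n ^ r :=
          mul_lt_mul_of_pos_right hlt (by positivity)
      _ ≤ ((x + 1) ^ p * B) ^ (2 * q) * (Real.exp (2 * p * q) * n ^ (-β)) :=
          mul_le_mul_of_nonneg_left hexp (by positivity)
      _ = _ := by rw [hTq]; ring
  have hM := mul_meas_ge_le_integral_of_nonneg
    (Filter.Eventually.of_forall fun θ => pow_nonneg (hZ θ) q) (hint q hq0) (T ^ q)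
  have h5 : T ^ q * P.real {θ | T ^ q ≤ Z θ ^ q} < T ^ q * n ^ (-β) :=
    (hM.trans (hE q hq0)).trans_lt hmain
  have h6 : P.real {θ | T ^ q ≤ Z θ ^ q} < n ^ (-β) :=
    lt_of_mul_lt_mul_left h5 (by positivity)
  have h7 : P.real {θ | T < Z θ} < n ^ (-β) := by
    refine lt_of_le_of_lt (measureReal_mono ?_) h6
    intro θ hθ
    exact pow_le_pow_left₀ hT0.le (le_of_lt hθ) q
  exact (ENNReal.lt_ofReal_iff_toReal_lt (measure_ne_top _ _)).mpr h7
end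

section
/- There is the following high-probability spectral norm bound. Let n₁, n₂, n₃ ≥ 2 be integers with n_max = max{n₁,n₂,n₃}, let r ≥ 1, μ ≥ 1, B > 0, C ≥ 1, β > 0 with μr ≤ min{n₁,n₂,n₃}, and suppose m satisfies m > 10000·C·(2+β)²·n_max·r·μ²·ln(n_max) and m > 10000·C·(2+β)²·r·√(n₁)·max{n₂,n₃}·μ^{3/2}·ln(n_max) and m ≤ n₁n₂n₃. Let A be a fixed (B,r,μ)-bounded n₁×n₂×n₃ tensor, let Ω ⊆ [n₁]×[n₂]×[n₃] be random with each triple included independently with probability m/(n₁n₂n₃), and let Y be the (n₂n₃)×(n₂n₃) random matrix with entries Y_{(b,c),(b',c')} = Σ_{a=1}^{n₁} (R̄_Ω A)_{a,b,c'}·(R̄_Ω A)_{a,b',c}. Then Pr[‖Y‖ > B·n₁n₂n₃/(C·r·μ³)] < 4·n_max^{−(β+1)}, where ‖Y‖ is the spectral norm. -/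
open scoped BigOperators ENNReal
open MeasureTheory

/-- The Bernoulli measure on `Bool` with success probability `p`. -/
noncomputable def bern (p : ℝ≥0∞) : Measure Bool :=
  p • Measure.dirac true + (1 - p) • Measure.dirac false

/-- An `n₁ × n₂ × n₃` tensor `A` is `(B, r, μ)`-bounded. -/
def IsBdd (n₁ n₂ n₃ : ℕ) (A : Fin n₁ → Fin n₂ → Fin n₃ → ℝ) (B r μ : ℝ) : Prop :=
  (∀ a b c, (A a b c) ^ 2 ≤ B * r) ∧
  (∀ b c, (1 / n₁ : ℝ) * (∑ a, (A a b c) ^ 2) ≤ B / μ) ∧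
  (∀ a c, (1 / n₂ : ℝ) * (∑ b, (A a b c) ^ 2) ≤ B / μ) ∧
  (∀ a b, (1 / n₃ : ℝ) * (∑ c, (A a b c) ^ 2) ≤ B / μ) ∧
  (∀ c, (1 / (n₁ * n₂) : ℝ) * (∑ a, ∑ b, (A a b c) ^ 2) ≤ B / μ ^ 2) ∧
  (∀ b, (1 / (n₁ * n₃) : ℝ) * (∑ a, ∑ c, (A a b c) ^ 2) ≤ B / μ ^ 2) ∧
  (∀ a, (1 / (n₂ * n₃) : ℝ) * (∑ b, ∑ c, (A a b c) ^ 2) ≤ B / μ ^ 2) ∧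
  ((1 / (n₁ * n₂ * n₃) : ℝ) * (∑ a, ∑ b, ∑ c, (A a b c) ^ 2) ≤ B / μ ^ 3)


namespace TC
open Matrix

lemma spec {n : Type*} [Fintype n] [DecidableEq n] (A : Matrix n n ℝ) (hA : Aᵀ = A) :
    ∃ (U : Matrix n n ℝ) (d : n → ℝ), Uᵀ * U = 1 ∧ U * Uᵀ = 1 ∧
      ∀ k : ℕ, A ^ k = U * diagonal (fun i => d i ^ k) * Uᵀ := by
  have hH : A.IsHermitian := by
    rw [Matrix.IsHermitian, conjTranspose_eq_transpose_of_trivial, hA]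
  have h1 := hH.spectral_theorem
  rw [Unitary.conjStarAlgAut_apply] at h1
  set U : Matrix n n ℝ := (hH.eigenvectorUnitary : Matrix n n ℝ) with hU
  have hs : star U = Uᵀ := by
    rw [star_eq_conjTranspose, conjTranspose_eq_transpose_of_trivial]
  have hu1 : Uᵀ * U = 1 := by
    rw [← hs]; exact Unitary.coe_star_mul_self hH.eigenvectorUnitary
  have hu2 : U * Uᵀ = 1 := by
    rw [← hs]; exact Unitary.coe_mul_star_self hH.eigenvectorUnitary
  have h2 : A = U * diagonal hH.eigenvalues * Uᵀ := by
    rw [← hs]; exact h1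
  generalize hH.eigenvalues = d at h2
  clear_value U
  refine ⟨U, d, hu1, hu2, ?_⟩
  intro k
  induction k with
  | zero => simp [hu2]
  | succ k ih =>
    rw [pow_succ, ih]
    conv_lhs => rw [h2]
    calc U * diagonal (fun i => d i ^ k) * Uᵀ * (U * diagonal d * Uᵀ)
        = U * diagonal (fun i => d i ^ k) * (Uᵀ * U) * diagonal d * Uᵀ := by
          simp only [Matrix.mul_assoc]
      _ = _ := by
          rw [hu1, Matrix.mul_one, Matrix.mul_assoc U, diagonal_mul_diagonal]
          simp only [pow_succ]

lemma scal_ineq (a b : ℝ) (k : ℕ) :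
    ∑ j ∈ Finset.range (2*k+1), a^j * b^(2*k-j) ≤ (2*k+1 : ℝ)/2 * (a^(2*k) + b^(2*k)) := by
  have h1 : ∑ j ∈ Finset.range (2*k+1), a^j * b^(2*k-j)
      = ∑ j ∈ Finset.range (2*k+1), a^(2*k-j) * b^j := by
    rw [← Finset.sum_range_reflect]
    apply Finset.sum_congr rfl
    intro j hj
    have := Finset.mem_range.1 hj
    congr 2 <;> omega
  have h2 : ∀ j ∈ Finset.range (2*k+1), a^j * b^(2*k-j) + a^(2*k-j) * b^j ≤ a^(2*k) + b^(2*k) := by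
    intro j hj
    have hj := Finset.mem_range.1 hj
    obtain ⟨l, hl⟩ : ∃ l, 2*k = j + l := ⟨2*k-j, by omega⟩
    have e : 2*k - j = l := by omega
    rw [e]
    have ha : a^(2*k) = |a|^j * |a|^l := by rw [← pow_add, ← hl, pow_mul, pow_mul, sq_abs]
    have hb : b^(2*k) = |b|^j * |b|^l := by rw [← pow_add, ← hl, pow_mul, pow_mul, sq_abs]
    rw [ha, hb]
    have i1 : a^j*b^l ≤ |a|^j*|b|^l := by
      rw [← abs_pow, ← abs_pow, ← abs_mul]; exact le_abs_self _
    have i2 : a^l*b^j ≤ |a|^l*|b|^j := by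
      rw [← abs_pow, ← abs_pow, ← abs_mul]; exact le_abs_self _
    have i3 : 0 ≤ (|a|^j - |b|^j) * (|a|^l - |b|^l) := by
      rcases le_total |a| |b| with h | h
      · apply mul_nonneg_of_nonpos_of_nonpos <;> rw [sub_nonpos] <;>
          exact pow_le_pow_left₀ (abs_nonneg _) h _
      · apply mul_nonneg <;> rw [sub_nonneg] <;>
          exact pow_le_pow_left₀ (abs_nonneg _) h _
    nlinarith
  have h3 := Finset.sum_le_sum h2
  rw [Finset.sum_add_distrib, ← h1] at h3
  simp at h3
  linarith

lemma trace_form {n : Type*} [Fintype n] [DecidableEq n] (H A B : Matrix n n ℝ)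
    (hH : Hᵀ = H) (hA : Aᵀ = A) (hB : Bᵀ = B) :
    ∃ (K : n → n → ℝ) (a b : n → ℝ), ∀ j l : ℕ,
      trace (H * A^j * H * B^l) = ∑ s, ∑ t, (K s t)^2 * (a s ^ j * b t ^ l) := by
  obtain ⟨U, a, hU1, hU2, hUa⟩ := spec A hA
  obtain ⟨W, b, hW1, hW2, hWb⟩ := spec B hB
  refine ⟨fun s t => (Uᵀ * H * W) s t, a, b, ?_⟩
  intro j l
  have h1 : trace (H * A^j * H * B^l) =
      trace ((Uᵀ * H * W)ᵀ * diagonal (fun i => a i ^ j) * (Uᵀ * H * W) * diagonal (fun i => b i ^ l)) := by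
    rw [hUa, hWb]
    rw [show H * (U * diagonal (fun i => a i ^ j) * Uᵀ) * H * (W * diagonal (fun i => b i ^ l) * Wᵀ)
      = (H * (U * diagonal (fun i => a i ^ j) * Uᵀ) * H * (W * diagonal (fun i => b i ^ l))) * Wᵀ by
        simp only [Matrix.mul_assoc]]
    rw [trace_mul_comm]
    simp only [transpose_mul, transpose_transpose, hH, Matrix.mul_assoc]
  rw [h1]
  simp only [trace, diag_apply, mul_diagonal]
  rw [Finset.sum_comm]
  apply Finset.sum_congr rfl
  intro t _
  rw [Matrix.mul_apply, Finset.sum_mul]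
  apply Finset.sum_congr rfl
  intro s _
  rw [mul_diagonal, transpose_apply]
  ring

lemma trace_ineq {n : Type*} [Fintype n] [DecidableEq n] (H A B : Matrix n n ℝ)
    (hH : Hᵀ = H) (hA : Aᵀ = A) (hB : Bᵀ = B) (k : ℕ) :
    ∑ j ∈ Finset.range (2*k+1), trace (H * A^j * H * B^(2*k-j)) ≤
      (2*k+1 : ℝ)/2 * (trace (H * H * A^(2*k)) + trace (H * H * B^(2*k))) := by
  obtain ⟨K, a, b, h⟩ := trace_form H A B hH hA hB
  have e1 : trace (H * H * A^(2*k)) = trace (H * A^(2*k) * H * B^0) := by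
    rw [pow_zero, Matrix.mul_one, trace_mul_cycle, Matrix.mul_assoc, trace_mul_comm, Matrix.mul_assoc,
      trace_mul_comm]
  have e2 : trace (H * H * B^(2*k)) = trace (H * A^0 * H * B^(2*k)) := by
    rw [pow_zero, Matrix.mul_one]
  rw [e1, e2]
  simp only [h]
  rw [Finset.sum_comm, ← Finset.sum_add_distrib, Finset.mul_sum]
  apply Finset.sum_le_sum
  intro s _
  rw [Finset.sum_comm, ← Finset.sum_add_distrib, Finset.mul_sum]
  apply Finset.sum_le_sum
  intro t _
  have := mul_le_mul_of_nonneg_left (scal_ineq (a s) (b t) k) (sq_nonneg (K s t))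
  rw [Finset.mul_sum] at this
  simp only [pow_zero, mul_one, one_mul]
  linarith

end TC


namespace TC
open Matrix

section Expect

noncomputable def wt {ι : Type*} [Fintype ι] (p : ℝ) (ω : ι → Bool) : ℝ :=
  ∏ i, if ω i then p else 1 - p

noncomputable def E {ι : Type*} [Fintype ι] [DecidableEq ι] {V : Type*} [AddCommGroup V] [Module ℝ V]
    (p : ℝ) (f : (ι → Bool) → V) : V := ∑ ω, wt p ω • f ω

variable {ι κ : Type*} [Fintype ι] [DecidableEq ι] [Fintype κ] [DecidableEq κ]
variable {V : Type*} [AddCommGroup V] [Module ℝ V]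

lemma wt_nonneg {p : ℝ} (h0 : 0 ≤ p) (h1 : p ≤ 1) (ω : ι → Bool) : 0 ≤ wt p ω := by
  apply Finset.prod_nonneg
  intro i _
  split_ifs <;> linarith

lemma E_prod (p : ℝ) (g : ι → Bool → ℝ) :
    E p (fun ω => ∏ i, g i (ω i)) = ∏ i, (p * g i true + (1 - p) * g i false) := by
  have h : ∀ i, (p * g i true + (1 - p) * g i false) = ∑ b : Bool, (if b then p else 1 - p) * g i b := by
    intro i; simp
  simp only [h]
  rw [Finset.prod_univ_sum]
  simp only [Fintype.piFinset_univ, E, wt, smul_eq_mul]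
  apply Finset.sum_congr rfl
  intro ω _
  rw [← Finset.prod_mul_distrib]

lemma sum_wt (p : ℝ) : ∑ ω : ι → Bool, wt p ω = 1 := by
  have := E_prod (ι := ι) p (fun _ _ => 1)
  simpa [E] using this

lemma E_const (p : ℝ) (c : V) : E p (fun _ : ι → Bool => c) = c := by
  rw [E, ← Finset.sum_smul, sum_wt, one_smul]

lemma E_add (p : ℝ) (f g : (ι → Bool) → V) : E p (fun ω => f ω + g ω) = E p f + E p g := by
  simp [E, smul_add, Finset.sum_add_distrib]

lemma E_sub (p : ℝ) (f g : (ι → Bool) → V) : E p (fun ω => f ω - g ω) = E p f - E p g := by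
  simp [E, smul_sub, Finset.sum_sub_distrib]

lemma E_smul (p c : ℝ) (f : (ι → Bool) → V) : E p (fun ω => c • f ω) = c • E p f := by
  simp only [E, Finset.smul_sum]
  exact Finset.sum_congr rfl fun ω _ => smul_comm _ _ _

lemma E_mul (p c : ℝ) (f : (ι → Bool) → ℝ) : E p (fun ω => c * f ω) = c * E p f :=
  E_smul p c f

lemma E_sum {α : Type*} (p : ℝ) (s : Finset α) (f : α → (ι → Bool) → V) :
    E p (fun ω => ∑ a ∈ s, f a ω) = ∑ a ∈ s, E p (f a) := by
  simp only [E, Finset.smul_sum]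
  rw [Finset.sum_comm]

lemma E_comm (p p' : ℝ) (f : (ι → Bool) → (κ → Bool) → V) :
    E p (fun ω => E p' (fun η => f ω η)) = E p' (fun η => E p (fun ω => f ω η)) := by
  simp only [E, Finset.smul_sum]
  rw [Finset.sum_comm]
  exact Finset.sum_congr rfl fun ω _ => Finset.sum_congr rfl fun _ _ => smul_comm _ _ _

lemma E_mono {p : ℝ} (h0 : 0 ≤ p) (h1 : p ≤ 1) {f g : (ι → Bool) → ℝ} (h : ∀ ω, f ω ≤ g ω) :
    E p f ≤ E p g :=
  Finset.sum_le_sum fun ω _ => mul_le_mul_of_nonneg_left (h ω) (wt_nonneg h0 h1 ω)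

lemma E_nonneg {p : ℝ} (h0 : 0 ≤ p) (h1 : p ≤ 1) {f : (ι → Bool) → ℝ} (h : ∀ ω, 0 ≤ f ω) :
    0 ≤ E p f :=
  Finset.sum_nonneg fun ω _ => mul_nonneg (wt_nonneg h0 h1 ω) (h ω)

lemma E_le_const {p : ℝ} (h0 : 0 ≤ p) (h1 : p ≤ 1) {f : (ι → Bool) → ℝ} {c : ℝ} (h : ∀ ω, f ω ≤ c) :
    E p f ≤ c := by
  have := E_mono h0 h1 (g := fun _ => c) h
  rwa [E_const] at this

lemma E_apply {m n : Type*} (p : ℝ) (f : (ι → Bool) → Matrix m n ℝ) (i : m) (j : n) :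
    (E p f) i j = E p (fun ω => f ω i j) := by
  simp [E, Matrix.sum_apply]

lemma norm_E_le {W : Type*} [NormedAddCommGroup W] [NormedSpace ℝ W] {p : ℝ} (h0 : 0 ≤ p) (h1 : p ≤ 1)
    (f : (ι → Bool) → W) : ‖E p f‖ ≤ E p (fun ω => ‖f ω‖) := by
  refine (norm_sum_le _ _).trans (Finset.sum_le_sum fun ω _ => ?_)
  rw [norm_smul, Real.norm_of_nonneg (wt_nonneg h0 h1 ω), smul_eq_mul]

def mix (s : ι → Bool) (ω ω' : ι → Bool) : ι → Bool := fun i => if s i then ω i else ω' i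

lemma wt_mix (p : ℝ) (s ω ω' : ι → Bool) :
    wt p (mix s ω ω') * wt p (mix s ω' ω) = wt p ω * wt p ω' := by
  simp only [wt, ← Finset.prod_mul_distrib]
  apply Finset.prod_congr rfl
  intro i _
  simp only [mix]
  by_cases h : s i <;> simp [h, mul_comm]

lemma mix_mix (s ω ω' : ι → Bool) : mix s (mix s ω ω') (mix s ω' ω) = ω := by
  funext i; by_cases h : s i <;> simp [mix, h]

lemma E_mix (p : ℝ) (s : ι → Bool) (f : (ι → Bool) → (ι → Bool) → V) :
    E p (fun ω => E p (fun ω' => f (mix s ω ω') (mix s ω' ω))) = E p (fun ω => E p (fun ω' => f ω ω')) := by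
  have key : ∀ g : (ι → Bool) → (ι → Bool) → V, E p (fun ω => E p (fun ω' => g ω ω')) =
      ∑ x : (ι → Bool) × (ι → Bool), (wt p x.1 * wt p x.2) • g x.1 x.2 := by
    intro g
    simp only [E, Finset.smul_sum, Fintype.sum_prod_type, smul_smul]
  rw [key, key]
  let e : (ι → Bool) × (ι → Bool) → (ι → Bool) × (ι → Bool) := fun x => (mix s x.1 x.2, mix s x.2 x.1)
  have he : Function.Involutive e := by
    intro x; simp [e, mix_mix]
  rw [← Equiv.sum_comp he.toPerm]
  apply Finset.sum_congr rfl
  intro x _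
  simp only [Function.Involutive.coe_toPerm, e, mix_mix, wt_mix]

lemma E_mix1 (p : ℝ) (s : ι → Bool) (f : (ι → Bool) → V) :
    E p (fun ω => E p (fun ω' => f (mix s ω ω'))) = E p f := by
  rw [E_mix p s (fun x _ => f x)]
  simp only [E_const]

def flip (i : ι) (ω : ι → Bool) : ι → Bool := Function.update ω i (!ω i)

lemma flip_flip (i : ι) : Function.Involutive (flip i : (ι → Bool) → ι → Bool) := by
  intro ω; simp [flip]

lemma wt_half (ω ω' : ι → Bool) : wt (1/2) ω = wt (1/2) ω' := by
  simp only [wt]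
  apply Finset.prod_congr rfl
  intro i _
  split_ifs <;> norm_num

lemma E_flip (i : ι) (f : (ι → Bool) → V) :
    E (1/2) (fun ω => f (flip i ω)) = E (1/2) f := by
  simp only [E]
  rw [← Equiv.sum_comp (flip_flip i).toPerm (fun ω => wt (1/2) ω • f ω)]
  apply Finset.sum_congr rfl
  intro ω _
  simp only [Function.Involutive.coe_toPerm]
  rw [wt_half ω (flip i ω)]

noncomputable def sg (b : Bool) : ℝ := if b then 1 else -1

lemma sg_not (b : Bool) : sg (!b) = - sg b := by cases b <;> simp [sg]
lemma sg_sq (b : Bool) : sg b * sg b = 1 := by cases b <;> simp [sg]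

lemma flip_same (i : ι) (ω : ι → Bool) : flip i ω i = !ω i := by simp [flip]
lemma flip_ne {i j : ι} (h : j ≠ i) (ω : ι → Bool) : flip i ω j = ω j := by simp [flip, h]

lemma E_trace {n : Type*} [Fintype n] (p : ℝ) (f : (ι → Bool) → Matrix n n ℝ) :
    trace (E p f) = E p (fun ω => trace (f ω)) := by
  simp [E, trace_sum]

end Expect

section Khin

variable {ι n : Type*} [Fintype ι] [DecidableEq ι] [Fintype n] [DecidableEq n]

noncomputable def rad {m : Type*} (H : ι → Matrix m n ℝ) (ε : ι → Bool) : Matrix m n ℝ := ∑ i, sg (ε i) • H i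

lemma rad_flip (H : ι → Matrix n n ℝ) (ε : ι → Bool) (i : ι) :
    rad H ε - rad H (flip i ε) = (2 * sg (ε i)) • H i := by
  rw [rad, rad, ← Finset.sum_sub_distrib, Finset.sum_eq_single i]
  · rw [flip_same, sg_not, ← sub_smul]; congr 1; ring
  · intro j _ hj
    rw [flip_ne hj, sub_self]
  · simp

lemma rad_symm (H : ι → Matrix n n ℝ) (hH : ∀ i, (H i)ᵀ = H i) (ε : ι → Bool) : (rad H ε)ᵀ = rad H ε := by
  simp [rad, transpose_sum, hH]

lemma pow_sub_pow_nc (A B : Matrix n n ℝ) (k : ℕ) :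
    A^k - B^k = ∑ j ∈ Finset.range k, A^j * (A - B) * B^(k-1-j) := by
  induction k with
  | zero => simp
  | succ k ih =>
    have h : A^(k+1) - B^(k+1) = (A^k - B^k) * B + A^k * (A - B) := by
      rw [pow_succ, pow_succ]; noncomm_ring
    rw [h, ih, Finset.sum_range_succ, Finset.sum_mul]
    congr 1
    · apply Finset.sum_congr rfl
      intro j hj
      have := Finset.mem_range.1 hj
      rw [Matrix.mul_assoc _ _ B, ← pow_succ]
      congr 2; omega
    · simp

lemma khin_step (H : ι → Matrix n n ℝ) (hH : ∀ i, (H i)ᵀ = H i) (v : ℝ)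
    (hv : ∀ x : n → ℝ, ∑ i, (H i *ᵥ x) ⬝ᵥ (H i *ᵥ x) ≤ v * (x ⬝ᵥ x)) (k : ℕ) :
    E (1/2) (fun ε => trace (rad H ε ^ (2*k+2))) ≤ (2*k+1) * v * E (1/2) (fun ε => trace (rad H ε ^ (2*k))) := by
  have h0 : (0:ℝ) ≤ 1/2 := by norm_num
  have h1 : (1/2:ℝ) ≤ 1 := by norm_num
  have e1 : E (1/2) (fun ε => trace (rad H ε ^ (2*k+2))) =
      ∑ i, E (1/2) (fun ε => sg (ε i) * trace (H i * rad H ε ^ (2*k+1))) := by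
    rw [← E_sum]
    congr 1; funext ε
    rw [pow_succ']
    conv_lhs => enter [1, 1]; rw [rad]
    rw [Finset.sum_mul, trace_sum]
    apply Finset.sum_congr rfl
    intro i _
    rw [smul_mul_assoc, trace_smul, smul_eq_mul]
  have e2 : ∀ i, E (1/2) (fun ε => sg (ε i) * trace (H i * rad H ε ^ (2*k+1))) ≤
      (2*k+1) * E (1/2) (fun ε => trace (H i * H i * rad H ε ^ (2*k))) := by
    intro i
    have f1 : E (1/2) (fun ε => sg (ε i) * trace (H i * rad H ε ^ (2*k+1))) =
        E (1/2) (fun ε => - sg (ε i) * trace (H i * rad H (flip i ε) ^ (2*k+1))) := by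
      rw [← E_flip i]
      congr 1; funext ε
      rw [flip_same, sg_not]
    have f2 : 2 * E (1/2) (fun ε => sg (ε i) * trace (H i * rad H ε ^ (2*k+1))) =
        E (1/2) (fun ε => 2 * ∑ j ∈ Finset.range (2*k+1),
          trace (H i * rad H ε ^ j * H i * rad H (flip i ε) ^ (2*k-j))) := by
      rw [two_mul]
      conv_lhs => enter [2]; rw [f1]
      rw [← E_add]
      congr 1; funext ε
      have : sg (ε i) * trace (H i * rad H ε ^ (2*k+1)) + - sg (ε i) * trace (H i * rad H (flip i ε) ^ (2*k+1))
        = sg (ε i) * trace (H i * (rad H ε ^ (2*k+1) - rad H (flip i ε) ^ (2*k+1))) := by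
        rw [Matrix.mul_sub, trace_sub]; ring
      rw [this, pow_sub_pow_nc, rad_flip, Finset.mul_sum, trace_sum, Finset.mul_sum, Finset.mul_sum]
      apply Finset.sum_congr rfl
      intro j _
      rw [Matrix.mul_smul, Matrix.smul_mul, Matrix.mul_smul, trace_smul, smul_eq_mul]
      rw [show 2*k+1-1-j = 2*k-j by omega]
      rw [← mul_assoc, show sg (ε i) * (2 * sg (ε i)) = 2 * (sg (ε i) * sg (ε i)) by ring, sg_sq, mul_one]
      simp only [Matrix.mul_assoc]
    have f3 : E (1/2) (fun ε => 2 * ∑ j ∈ Finset.range (2*k+1),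
          trace (H i * rad H ε ^ j * H i * rad H (flip i ε) ^ (2*k-j))) ≤
        E (1/2) (fun ε => (2*k+1) * (trace (H i * H i * rad H ε ^ (2*k)) +
          trace (H i * H i * rad H (flip i ε) ^ (2*k)))) := by
      apply E_mono h0 h1
      intro ε
      have := trace_ineq (H i) (rad H ε) (rad H (flip i ε)) (hH i) (rad_symm H hH ε) (rad_symm H hH _) k
      linarith
    have f4 : E (1/2) (fun ε => (2*k+1) * (trace (H i * H i * rad H ε ^ (2*k)) +
          trace (H i * H i * rad H (flip i ε) ^ (2*k)))) =
          2 * ((2*k+1) * E (1/2) (fun ε => trace (H i * H i * rad H ε ^ (2*k)))) := by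
      rw [E_mul, E_add, E_flip i (fun ε => trace (H i * H i * rad H ε ^ (2*k)))]
      ring
    linarith
  have e3 : ∑ i, E (1/2) (fun ε => trace (H i * H i * rad H ε ^ (2*k))) ≤
      v * E (1/2) (fun ε => trace (rad H ε ^ (2*k))) := by
    rw [← E_sum, ← E_mul]
    apply E_mono h0 h1
    intro ε
    have hZ : rad H ε ^ (2*k) = rad H ε ^ k * (rad H ε ^ k)ᵀ := by
      rw [transpose_pow, rad_symm H hH, ← pow_add, two_mul]
    rw [hZ]
    generalize rad H ε ^ k = Z
    have g1 : ∀ i, trace (H i * H i * (Z * Zᵀ)) = ∑ t, (H i *ᵥ (fun s => Z s t)) ⬝ᵥ (H i *ᵥ (fun s => Z s t)) := by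
      intro i
      have : trace (H i * H i * (Z * Zᵀ)) = trace ((H i * Z)ᵀ * (H i * Z)) := by
        rw [← Matrix.mul_assoc, trace_mul_comm, transpose_mul, hH]
        simp only [Matrix.mul_assoc]
      rw [this]
      rfl
    have g2 : trace (Z * Zᵀ) = ∑ t, (fun s => Z s t) ⬝ᵥ (fun s => Z s t) := by
      rw [trace_mul_comm]; rfl
    simp only [g1]
    rw [g2, Finset.sum_comm, Finset.mul_sum]
    exact Finset.sum_le_sum fun t _ => hv _
  rw [e1]
  calc _ ≤ ∑ i, (2*k+1) * E (1/2) (fun ε => trace (H i * H i * rad H ε ^ (2*k))) :=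
        Finset.sum_le_sum fun i _ => e2 i
    _ = (2*k+1) * ∑ i, E (1/2) (fun ε => trace (H i * H i * rad H ε ^ (2*k))) := by rw [Finset.mul_sum]
    _ ≤ _ := by rw [mul_assoc]; exact mul_le_mul_of_nonneg_left e3 (by positivity)

lemma khin (H : ι → Matrix n n ℝ) (hH : ∀ i, (H i)ᵀ = H i) (v : ℝ) (hv0 : 0 ≤ v)
    (hv : ∀ x : n → ℝ, ∑ i, (H i *ᵥ x) ⬝ᵥ (H i *ᵥ x) ≤ v * (x ⬝ᵥ x)) (P : ℕ) (k : ℕ) (hk : k ≤ P) :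
    E (1/2) (fun ε => trace (rad H ε ^ (2*k))) ≤ Fintype.card n * (2 * P * v)^k := by
  induction k with
  | zero => simp [E_const]
  | succ k ih =>
    have ih := ih (by omega)
    have h := khin_step H hH v hv k
    have hkP : (2*k+1 : ℝ) ≤ 2 * P := by
      have : (k:ℝ) + 1 ≤ P := by exact_mod_cast hk
      linarith
    calc _ ≤ _ := h
      _ ≤ (2*k+1) * v * (Fintype.card n * (2 * P * v)^k) :=
        mul_le_mul_of_nonneg_left ih (by positivity)
      _ ≤ (2 * P) * v * (Fintype.card n * (2 * P * v)^k) := by gcongr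
      _ = _ := by rw [pow_succ]; ring

end Khin

end TC


namespace TC
open Matrix
open scoped Matrix.Norms.L2Operator

section Nrm

open Classical in
noncomputable def ind (P : Prop) : ℝ := if P then 1 else 0

lemma ind_nonneg (P : Prop) : 0 ≤ ind P := by unfold ind; split_ifs <;> norm_num
lemma ind_le_one (P : Prop) : ind P ≤ 1 := by unfold ind; split_ifs <;> norm_num
lemma ind_true {P : Prop} (h : P) : ind P = 1 := by simp [ind, h]
lemma ind_false {P : Prop} (h : ¬ P) : ind P = 0 := by simp [ind, h]
lemma ind_le {P : Prop} {x : ℝ} (h0 : 0 ≤ x) (h : P → 1 ≤ x) : ind P ≤ x := by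
  by_cases hP : P
  · rw [ind_true hP]; exact h hP
  · rw [ind_false hP]; exact h0
lemma ind_mono {P Q : Prop} (h : P → Q) : ind P ≤ ind Q :=
  ind_le (ind_nonneg _) fun hp => by rw [ind_true (h hp)]
lemma ind_or (P Q : Prop) : ind (P ∨ Q) ≤ ind P + ind Q := by
  apply ind_le (add_nonneg (ind_nonneg _) (ind_nonneg _))
  rintro (h | h)
  · rw [ind_true h]; linarith [ind_nonneg Q]
  · rw [ind_true h]; linarith [ind_nonneg P]
lemma ind_exists {α : Type*} [Fintype α] (P : α → Prop) : ind (∃ a, P a) ≤ ∑ a, ind (P a) := by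
  apply ind_le (Finset.sum_nonneg fun _ _ => ind_nonneg _)
  rintro ⟨a, ha⟩
  rw [← ind_true ha]
  exact Finset.single_le_sum (f := fun a => ind (P a)) (fun _ _ => ind_nonneg _) (Finset.mem_univ a)

variable {m n : Type*} [Fintype m] [DecidableEq m] [Fintype n] [DecidableEq n]

lemma dot_eq_norm (y : n → ℝ) : y ⬝ᵥ y = ‖(WithLp.toLp 2 y : EuclideanSpace ℝ n)‖^2 := by
  rw [EuclideanSpace.norm_sq_eq]
  simp [dotProduct, sq]

lemma nrm_le (M : Matrix m n ℝ) (t : ℝ) (ht : 0 ≤ t)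
    (h : ∀ y : n → ℝ, (M *ᵥ y) ⬝ᵥ (M *ᵥ y) ≤ t^2 * (y ⬝ᵥ y)) : ‖M‖ ≤ t := by
  rw [l2_opNorm_def]
  apply ContinuousLinearMap.opNorm_le_bound _ ht
  intro x
  have := h x.ofLp
  rw [dot_eq_norm, dot_eq_norm, ← mul_pow] at this
  exact (pow_le_pow_iff_left₀ (norm_nonneg _) (by positivity) two_ne_zero).1 this

lemma le_nrm (M : Matrix m n ℝ) (y : n → ℝ) :
    (M *ᵥ y) ⬝ᵥ (M *ᵥ y) ≤ ‖M‖^2 * (y ⬝ᵥ y) := by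
  rw [dot_eq_norm, dot_eq_norm, ← mul_pow]
  exact pow_le_pow_left₀ (norm_nonneg _) (l2_opNorm_mulVec M (WithLp.toLp 2 y)) 2

lemma nrm_transpose (M : Matrix m n ℝ) : ‖Mᵀ‖ = ‖M‖ := by
  rw [← conjTranspose_eq_transpose_of_trivial, l2_opNorm_conjTranspose]

lemma nrm_orth (U : Matrix n n ℝ) (h : Uᵀ * U = 1) : ‖U‖ ≤ 1 := by
  apply nrm_le _ _ zero_le_one
  intro y
  rw [dotProduct_mulVec, vecMul_mulVec, ← dotProduct_mulVec, h, one_mulVec]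
  simp

lemma pow_nrm_le (X : Matrix n n ℝ) (hX : Xᵀ = X) (k : ℕ) (hk : 1 ≤ k) :
    ‖X‖^(2*k) ≤ trace (X^(2*k)) := by
  obtain ⟨U, d, h1, h2, h⟩ := spec X hX
  have hX1 : X = U * diagonal d * Uᵀ := by simpa using h 1
  have hn : ‖X‖ ≤ ‖d‖ := by
    rw [hX1]
    calc _ ≤ ‖U * diagonal d‖ * ‖Uᵀ‖ := l2_opNorm_mul _ _
      _ ≤ (‖U‖ * ‖(diagonal d : Matrix n n ℝ)‖) * ‖Uᵀ‖ := by gcongr; exact l2_opNorm_mul _ _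
      _ ≤ (1 * ‖d‖) * 1 := by
        rw [l2_opNorm_diagonal]
        gcongr
        · exact nrm_orth U h1
        · rw [nrm_transpose]; exact nrm_orth U h1
      _ = ‖d‖ := by ring
  have ht : trace (X^(2*k)) = ∑ i, d i ^ (2*k) := by
    rw [h, trace_mul_comm, ← Matrix.mul_assoc, h1, Matrix.one_mul, trace_diagonal]
  rw [ht]
  refine (pow_le_pow_left₀ (norm_nonneg _) hn _).trans ?_
  rcases isEmpty_or_nonempty n with he | he
  · have : d = 0 := Subsingleton.elim _ _
    rw [this, norm_zero, zero_pow (by omega)]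
    simp
  · obtain ⟨i, hi⟩ : ∃ i, ‖d‖ = ‖d i‖ := by
      obtain ⟨i, -, hi⟩ := Finset.exists_max_image Finset.univ (fun i => ‖d i‖) Finset.univ_nonempty
      exact ⟨i, le_antisymm ((pi_norm_le_iff_of_nonneg (norm_nonneg _)).2 fun j => hi j (Finset.mem_univ j))
        (norm_le_pi_norm d i)⟩
    rw [hi, Real.norm_eq_abs, pow_mul, sq_abs, ← pow_mul]
    apply Finset.single_le_sum (f := fun i => d i ^ (2*k)) (fun j _ => ?_) (Finset.mem_univ i)
    rw [pow_mul]; positivity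

def dil (M : Matrix m n ℝ) : Matrix (m ⊕ n) (m ⊕ n) ℝ := fromBlocks 0 M Mᵀ 0

lemma dil_mulVec (M : Matrix m n ℝ) (x : m → ℝ) (y : n → ℝ) :
    dil M *ᵥ Sum.elim x y = Sum.elim (M *ᵥ y) (Mᵀ *ᵥ x) := by
  rw [dil, fromBlocks_mulVec]
  simp

lemma nrm_dil (M : Matrix m n ℝ) : ‖M‖ ≤ ‖dil M‖ := by
  apply nrm_le _ _ (norm_nonneg _)
  intro y
  have := le_nrm (dil M) (Sum.elim 0 y)
  rw [dil_mulVec] at this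
  simpa using this

variable {ι : Type*} [Fintype ι] [DecidableEq ι]

lemma dil_rad (M : ι → Matrix m n ℝ) (ε : ι → Bool) :
    dil (rad M ε) = rad (fun i => dil (M i)) ε := by
  ext i j
  rcases i with i | i <;> rcases j with j | j <;> simp [dil, rad, Matrix.sum_apply]

lemma khin_rect (M : ι → Matrix m n ℝ) (v : ℝ) (hv0 : 0 ≤ v)
    (hv1 : ∀ y : n → ℝ, ∑ i, (M i *ᵥ y) ⬝ᵥ (M i *ᵥ y) ≤ v * (y ⬝ᵥ y))
    (hv2 : ∀ x : m → ℝ, ∑ i, ((M i)ᵀ *ᵥ x) ⬝ᵥ ((M i)ᵀ *ᵥ x) ≤ v * (x ⬝ᵥ x)) (P : ℕ) (hP : 1 ≤ P) :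
    E (1/2) (fun ε => ‖rad M ε‖^(2*P)) ≤ (Fintype.card m + Fintype.card n) * (2 * P * v)^P := by
  have h := khin (fun i => dil (M i)) (fun i => by simp [dil, fromBlocks_transpose]) v hv0 (by
    intro z
    obtain ⟨x, y, rfl⟩ : ∃ x y, z = Sum.elim x y := ⟨z ∘ Sum.inl, z ∘ Sum.inr, by simp⟩
    simp only [dil_mulVec, sumElim_dotProduct_sumElim, Finset.sum_add_distrib]
    linarith [hv1 y, hv2 x]) P P le_rfl
  rw [Fintype.card_sum] at h
  push_cast at h
  refine le_trans (E_mono (by norm_num) (by norm_num) ?_) h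
  intro ε
  rw [← dil_rad]
  refine (pow_le_pow_left₀ (norm_nonneg _) (nrm_dil _) _).trans (pow_nrm_le _ ?_ P hP)
  simp [dil, fromBlocks_transpose]

lemma tail (M : ι → Matrix m n ℝ) (v : ℝ) (hv0 : 0 < v)
    (hv1 : ∀ y : n → ℝ, ∑ i, (M i *ᵥ y) ⬝ᵥ (M i *ᵥ y) ≤ v * (y ⬝ᵥ y))
    (hv2 : ∀ x : m → ℝ, ∑ i, ((M i)ᵀ *ᵥ x) ⬝ᵥ ((M i)ᵀ *ᵥ x) ≤ v * (x ⬝ᵥ x)) (P : ℕ) (hP : 1 ≤ P) :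
    E (1/2) (fun ε => ind (8 * (2 * P) * v < ‖rad M ε‖^2)) ≤
      (Fintype.card m + Fintype.card n) * Real.exp (-(2*P)) := by
  have hPp : (0:ℝ) < P := by exact_mod_cast hP
  have h := khin_rect M v hv0.le hv1 hv2 P hP
  have hc : (0:ℝ) < (8 * (2 * P) * v)^P := by positivity
  have h1 : E (1/2) (fun ε => ind (8 * (2 * P) * v < ‖rad M ε‖^2)) ≤
      E (1/2) (fun ε => ((8 * (2 * P) * v)^P)⁻¹ * ‖rad M ε‖^(2*P)) := by
    apply E_mono (by norm_num) (by norm_num)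
    intro ε
    apply ind_le (by positivity)
    intro hlt
    rw [← div_eq_inv_mul, one_le_div hc, pow_mul]
    exact pow_le_pow_left₀ (by positivity) hlt.le _
  rw [E_mul] at h1
  refine h1.trans ?_
  calc ((8 * (2 * P) * v)^P)⁻¹ * E (1/2) (fun ε => ‖rad M ε‖^(2*P))
      ≤ ((8 * (2 * P) * v)^P)⁻¹ * ((Fintype.card m + Fintype.card n) * (2 * P * v)^P) := by gcongr
    _ = (Fintype.card m + Fintype.card n) * (1/8)^P := by
      rw [show (8 * (2 * P) * v) = 8 * (2 * P * v) by ring, mul_pow, one_div, inv_pow]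
      have : (2 * P * v)^P ≠ 0 := by positivity
      field_simp
    _ ≤ _ := by
      gcongr
      rw [show -(2*(P:ℝ)) = P * (-2) by ring, Real.exp_nat_mul]
      apply pow_le_pow_left₀ (by norm_num)
      rw [Real.exp_neg, one_div]
      apply inv_anti₀ (Real.exp_pos _)
      have h3 := Real.exp_one_lt_d9
      have : Real.exp 2 = Real.exp 1 * Real.exp 1 := by rw [← Real.exp_add]; norm_num
      rw [this]
      nlinarith [Real.exp_pos 1]

lemma sq_sum_unique (Q : n → Prop) [DecidablePred Q] (hQ : ∀ l l', Q l → Q l' → l = l') (f : n → ℝ) :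
    (∑ l, if Q l then f l else 0)^2 = ∑ l, if Q l then f l ^ 2 else 0 := by
  by_cases h : ∃ l, Q l
  · obtain ⟨l, hl⟩ := h
    rw [Finset.sum_eq_single l, Finset.sum_eq_single l, if_pos hl, if_pos hl]
    · intro l' _ h'; exact if_neg fun h2 => h' (hQ _ _ h2 hl)
    · simp
    · intro l' _ h'; exact if_neg fun h2 => h' (hQ _ _ h2 hl)
    · simp
  · have : ∀ l, ¬ Q l := fun l hl => h ⟨l, hl⟩
    simp [this]

lemma entries_aux (e : m → n → ι) (he : ∀ k l l', e k l = e k l' → l = l') (s : m → n → ℝ) (v : ℝ)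
    (h : ∀ l, ∑ k, s k l ^ 2 ≤ v) (y : n → ℝ) :
    ∑ i, ((of fun k l => if e k l = i then s k l else 0) *ᵥ y) ⬝ᵥ
      ((of fun k l => if e k l = i then s k l else 0) *ᵥ y) ≤ v * (y ⬝ᵥ y) := by
  have h1 : ∀ i, ((of fun k l => if e k l = i then s k l else 0) *ᵥ y) ⬝ᵥ
      ((of fun k l => if e k l = i then s k l else 0) *ᵥ y) =
      ∑ k, ∑ l, if e k l = i then (s k l * y l)^2 else 0 := by
    intro i
    simp only [dotProduct, mulVec, of_apply]
    apply Finset.sum_congr rfl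
    intro k _
    rw [← sq, ← sq_sum_unique (fun l => e k l = i) (fun l l' h h' => he k l l' (h.trans h'.symm))]
    simp only [ite_mul, zero_mul]
  simp only [h1]
  rw [Finset.sum_comm]
  simp_rw [Finset.sum_comm (s := (Finset.univ : Finset ι))]
  simp only [Finset.sum_ite_eq, Finset.mem_univ, if_true]
  rw [Finset.sum_comm, dotProduct, Finset.mul_sum]
  apply Finset.sum_le_sum
  intro l _
  have := mul_le_mul_of_nonneg_left (h l) (sq_nonneg (y l))
  rw [Finset.mul_sum] at this
  calc _ = ∑ k, y l ^ 2 * s k l ^ 2 := Finset.sum_congr rfl fun k _ => by ring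
    _ ≤ _ := this
    _ = _ := by ring

lemma tail_entries (e : m → n → ι) (he : ∀ k l k' l', e k l = e k' l' → k = k' ∧ l = l')
    (s : m → n → ℝ) (v : ℝ) (hv0 : 0 < v)
    (h1 : ∀ k, ∑ l, s k l ^ 2 ≤ v) (h2 : ∀ l, ∑ k, s k l ^ 2 ≤ v) (P : ℕ) (hP : 1 ≤ P) :
    E (1/2) (fun ε : ι → Bool =>
        ind (8 * (2 * P) * v < ‖(of fun k l => sg (ε (e k l)) * s k l : Matrix m n ℝ)‖^2)) ≤
      (Fintype.card m + Fintype.card n) * Real.exp (-(2*P)) := by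
  have h := tail (fun i : ι => (of fun k l => if e k l = i then s k l else 0 : Matrix m n ℝ)) v hv0
    (entries_aux e (fun k l l' h => (he _ _ _ _ h).2) s v h2)
    (entries_aux (fun l k => e k l) (fun k l l' h => (he _ _ _ _ h).1) (fun l k => s k l) v h1) P hP
  have h3 : ∀ ε : ι → Bool, rad (fun i : ι => (of fun k l => if e k l = i then s k l else 0 : Matrix m n ℝ)) ε
      = of fun k l => sg (ε (e k l)) * s k l := by
    intro ε
    ext k l
    simp [rad, Matrix.sum_apply]
  simp only [h3] at h
  exact h

end Nrm
end TC


namespace TC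
open Matrix
open scoped Matrix.Norms.L2Operator

section Tens

variable {α β γ : Type*} [Fintype α] [DecidableEq α] [Fintype β] [DecidableEq β] [Fintype γ] [DecidableEq γ]

def Yf (A : α → β → γ → ℝ) (z z' : α × β × γ → ℝ) : Matrix (β × γ) (β × γ) ℝ :=
  of fun p q => ∑ a, (z (a, p.1, q.2) * A a p.1 q.2) * (z' (a, q.1, p.2) * A a q.1 p.2)

def wS (A : α → β → γ → ℝ) (z : α × β × γ → ℝ) (a : α) (b : β) : ℝ := ∑ c, (z (a,b,c) * A a b c)^2
def vS (A : α → β → γ → ℝ) (z : α × β × γ → ℝ) (a : α) (c : γ) : ℝ := ∑ b, (z (a,b,c) * A a b c)^2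
def xS (A : α → β → γ → ℝ) (z : α × β × γ → ℝ) (b : β) (c : γ) : ℝ := ∑ a, (z (a,b,c) * A a b c)^2

lemma wS_nonneg (A : α → β → γ → ℝ) (z : α × β × γ → ℝ) (a : α) (b : β) : 0 ≤ wS A z a b :=
  Finset.sum_nonneg fun _ _ => sq_nonneg _
lemma vS_nonneg (A : α → β → γ → ℝ) (z : α × β × γ → ℝ) (a : α) (c : γ) : 0 ≤ vS A z a c :=
  Finset.sum_nonneg fun _ _ => sq_nonneg _

noncomputable def sz (ε : α × β × γ → Bool) (z : α × β × γ → ℝ) : α × β × γ → ℝ := fun i => sg (ε i) * z i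

noncomputable def D1 (A : α → β → γ → ℝ) (z z' : α × β × γ → ℝ) (c0 : γ) : Matrix (α × γ) β ℝ :=
  of fun k b' => Real.sqrt (vS A z k.1 c0) * (z' (k.1, b', k.2) * A k.1 b' k.2)

noncomputable def D2 (A : α → β → γ → ℝ) (z z' : α × β × γ → ℝ) (b0 : β) : Matrix (α × β) γ ℝ :=
  of fun k c' => Real.sqrt (wS A z k.1 b0) * (z' (k.1, k.2, c') * A k.1 k.2 c')

lemma D1_tail (A : α → β → γ → ℝ) (z z' : α × β × γ → ℝ) (c0 : γ) (v : ℝ) (hv : 0 < v)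
    (h2 : ∀ a c, vS A z a c0 * vS A z' a c ≤ v)
    (h4 : ∀ b, ∑ a, vS A z a c0 * wS A z' a b ≤ v) (P : ℕ) (hP : 1 ≤ P) :
    E (1/2) (fun ε => ind (8 * (2 * P) * v < ‖D1 A z (sz ε z') c0‖^2)) ≤
      (Fintype.card α * Fintype.card γ + Fintype.card β) * Real.exp (-(2*P)) := by
  have h := tail_entries (ι := α × β × γ) (fun (k : α × γ) (l : β) => (k.1, l, k.2))
    (fun k l k' l' h => by simp only [Prod.mk.injEq] at h; exact ⟨Prod.ext h.1 h.2.2, h.2.1⟩)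
    (fun k b' => Real.sqrt (vS A z k.1 c0) * (z' (k.1, b', k.2) * A k.1 b' k.2)) v hv
    (by
      intro k
      simp only [mul_pow _ _ 2, Real.sq_sqrt (vS_nonneg A z _ _), ← Finset.mul_sum]
      simpa only [vS, mul_pow] using h2 k.1 k.2)
    (by
      intro b
      simp only [mul_pow _ _ 2, Real.sq_sqrt (vS_nonneg A z _ _), Fintype.sum_prod_type, ← Finset.mul_sum]
      simpa only [vS, wS, mul_pow] using h4 b) P hP
  rw [Fintype.card_prod] at h
  push_cast at h
  refine le_trans (le_of_eq ?_) h
  congr 1; funext ε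
  congr 4
  ext k l
  simp only [D1, sz, of_apply]; ring

lemma D2_tail (A : α → β → γ → ℝ) (z z' : α × β × γ → ℝ) (b0 : β) (v : ℝ) (hv : 0 < v)
    (h1 : ∀ a b, wS A z a b0 * wS A z' a b ≤ v)
    (h3 : ∀ c, ∑ a, wS A z a b0 * vS A z' a c ≤ v) (P : ℕ) (hP : 1 ≤ P) :
    E (1/2) (fun ε => ind (8 * (2 * P) * v < ‖D2 A z (sz ε z') b0‖^2)) ≤
      (Fintype.card α * Fintype.card β + Fintype.card γ) * Real.exp (-(2*P)) := by
  have h := tail_entries (ι := α × β × γ) (fun (k : α × β) (l : γ) => (k.1, k.2, l))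
    (fun k l k' l' h => by simp only [Prod.mk.injEq] at h; exact ⟨Prod.ext h.1 h.2.1, h.2.2⟩)
    (fun k c' => Real.sqrt (wS A z k.1 b0) * (z' (k.1, k.2, c') * A k.1 k.2 c')) v hv
    (by
      intro k
      simp only [mul_pow _ _ 2, Real.sq_sqrt (wS_nonneg A z _ _), ← Finset.mul_sum]
      simpa only [wS, mul_pow] using h1 k.1 k.2)
    (by
      intro b
      simp only [mul_pow _ _ 2, Real.sq_sqrt (wS_nonneg A z _ _), Fintype.sum_prod_type, ← Finset.mul_sum]
      simpa only [vS, wS, mul_pow] using h3 b) P hP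
  rw [Fintype.card_prod] at h
  push_cast at h
  refine le_trans (le_of_eq ?_) h
  congr 1; funext ε
  congr 4
  ext k l
  simp only [D2, sz, of_apply]; ring

/-- coefficient matrices of the signed sum -/
def Mi (A : α → β → γ → ℝ) (z z' : α × β × γ → ℝ) (i : α × β × γ) : Matrix (β × γ) (β × γ) ℝ :=
  of fun p q => if p.1 = i.2.1 then (if q.2 = i.2.2 then
    (z i * A i.1 i.2.1 i.2.2) * (z' (i.1, q.1, p.2) * A i.1 q.1 p.2) else 0) else 0

lemma rad_Mi (A : α → β → γ → ℝ) (z z' : α × β × γ → ℝ) (ε : α × β × γ → Bool) :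
    rad (Mi A z z') ε = Yf A (sz ε z) z' := by
  ext p q
  simp only [rad, Matrix.sum_apply, Matrix.smul_apply, Mi, Yf, of_apply, Fintype.sum_prod_type, smul_eq_mul,
    mul_ite, mul_zero, sz]
  apply Finset.sum_congr rfl
  intro a _
  rw [Finset.sum_eq_single p.1, Finset.sum_eq_single q.2]
  · simp only [if_true]; ring
  · intro c _ hc
    simp [hc.symm]
  · simp
  · intro c _ hc
    simp [hc.symm]
  · simp

lemma Mi_1 (A : α → β → γ → ℝ) (z z' : α × β × γ → ℝ) (y : β × γ → ℝ) :
    ∑ i, (Mi A z z' i *ᵥ y) ⬝ᵥ (Mi A z z' i *ᵥ y) =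
      ∑ c0, (D1 A z z' c0 *ᵥ (fun b => y (b, c0))) ⬝ᵥ (D1 A z z' c0 *ᵥ (fun b => y (b, c0))) := by
  have h1 : ∀ a b0 c0, (Mi A z z' (a,b0,c0) *ᵥ y) ⬝ᵥ (Mi A z z' (a,b0,c0) *ᵥ y) =
      (z (a,b0,c0) * A a b0 c0)^2 * ∑ c, (∑ b', z' (a,b',c) * A a b' c * y (b', c0))^2 := by
    intro a b0 c0
    have : ∀ b c, (Mi A z z' (a,b0,c0) *ᵥ y) (b, c) = if b = b0 then
        (z (a,b0,c0) * A a b0 c0) * ∑ b', z' (a,b',c) * A a b' c * y (b', c0) else 0 := by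
      intro b c
      simp only [mulVec, dotProduct, Mi, of_apply, Fintype.sum_prod_type]
      by_cases h : b = b0
      · simp only [h, if_true, ite_mul, zero_mul, Finset.sum_ite_eq', Finset.mem_univ, Finset.mul_sum]
        exact Finset.sum_congr rfl fun _ _ => by ring
      · simp [h]
    simp only [dotProduct, Fintype.sum_prod_type, this, ← sq, ite_pow, zero_pow two_ne_zero]
    rw [Finset.sum_comm]
    simp only [Finset.sum_ite_eq', Finset.mem_univ, if_true, mul_pow _ _ 2, ← Finset.mul_sum]
  have h2 : ∀ c0, (D1 A z z' c0 *ᵥ (fun b => y (b, c0))) ⬝ᵥ (D1 A z z' c0 *ᵥ (fun b => y (b, c0))) =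
      ∑ a, vS A z a c0 * ∑ c, (∑ b', z' (a,b',c) * A a b' c * y (b', c0))^2 := by
    intro c0
    simp only [dotProduct, Fintype.sum_prod_type, ← sq, mulVec, D1, of_apply, mul_assoc, ← Finset.mul_sum]
    simp only [← Finset.mul_sum, mul_pow _ _ 2, Real.sq_sqrt (vS_nonneg A z _ _)]
  simp only [Fintype.sum_prod_type, h1, h2, vS, Finset.sum_mul]
  have : ∀ a, (∑ b0, ∑ c0, (z (a,b0,c0) * A a b0 c0)^2 * ∑ c, (∑ b', z' (a,b',c) * A a b' c * y (b', c0))^2)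
    = ∑ c0, ∑ b0, (z (a,b0,c0) * A a b0 c0)^2 * ∑ c, (∑ b', z' (a,b',c) * A a b' c * y (b', c0))^2 :=
    fun a => Finset.sum_comm
  simp only [this]
  rw [Finset.sum_comm]

lemma Mi_2 (A : α → β → γ → ℝ) (z z' : α × β × γ → ℝ) (x : β × γ → ℝ) :
    ∑ i, ((Mi A z z' i)ᵀ *ᵥ x) ⬝ᵥ ((Mi A z z' i)ᵀ *ᵥ x) =
      ∑ b0, (D2 A z z' b0 *ᵥ (fun c => x (b0, c))) ⬝ᵥ (D2 A z z' b0 *ᵥ (fun c => x (b0, c))) := by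
  have h1 : ∀ a b0 c0, ((Mi A z z' (a,b0,c0))ᵀ *ᵥ x) ⬝ᵥ ((Mi A z z' (a,b0,c0))ᵀ *ᵥ x) =
      (z (a,b0,c0) * A a b0 c0)^2 * ∑ b', (∑ c, z' (a,b',c) * A a b' c * x (b0, c))^2 := by
    intro a b0 c0
    have : ∀ b' c', ((Mi A z z' (a,b0,c0))ᵀ *ᵥ x) (b', c') = if c' = c0 then
        (z (a,b0,c0) * A a b0 c0) * ∑ c, z' (a,b',c) * A a b' c * x (b0, c) else 0 := by
      intro b' c'
      simp only [mulVec, dotProduct, Mi, transpose_apply, of_apply, Fintype.sum_prod_type]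
      rw [Finset.sum_comm]
      by_cases h : c' = c0
      · simp only [h, if_true, ite_mul, zero_mul, Finset.sum_ite_eq', Finset.mem_univ, Finset.mul_sum]
        exact Finset.sum_congr rfl fun _ _ => by ring
      · simp [h]
    simp only [dotProduct, Fintype.sum_prod_type, this, ← sq, ite_pow, zero_pow two_ne_zero]
    simp only [Finset.sum_ite_eq', Finset.mem_univ, if_true, mul_pow _ _ 2, ← Finset.mul_sum]
  have h2 : ∀ b0, (D2 A z z' b0 *ᵥ (fun c => x (b0, c))) ⬝ᵥ (D2 A z z' b0 *ᵥ (fun c => x (b0, c))) =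
      ∑ a, wS A z a b0 * ∑ b', (∑ c, z' (a,b',c) * A a b' c * x (b0, c))^2 := by
    intro b0
    simp only [dotProduct, Fintype.sum_prod_type, ← sq, mulVec, D2, of_apply, mul_assoc, ← Finset.mul_sum]
    simp only [← Finset.mul_sum, mul_pow _ _ 2, Real.sq_sqrt (wS_nonneg A z _ _)]
  simp only [Fintype.sum_prod_type, h1, h2, wS, Finset.sum_mul]
  rw [Finset.sum_comm]

lemma Y_sign (A : α → β → γ → ℝ) (z z' : α × β × γ → ℝ) (g : ℝ) (hg : 0 < g)
    (h1 : ∀ a b b', wS A z a b * wS A z' a b' ≤ g^2)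
    (h2 : ∀ a c c', vS A z a c * vS A z' a c' ≤ g^2)
    (h3 : ∀ b c, ∑ a, wS A z a b * vS A z' a c ≤ g^2)
    (h4 : ∀ b c, ∑ a, vS A z a c * wS A z' a b ≤ g^2) (P : ℕ) (hP : 1 ≤ P) (N : ℝ)
    (ha : Fintype.card α ≤ N) (hb : Fintype.card β ≤ N) (hc : Fintype.card γ ≤ N) (hN : 2 ≤ N) :
    E (1/2) (fun ε' => E (1/2) (fun ε => ind (8 * (2*P) * g < ‖Yf A (sz ε z) (sz ε' z')‖))) ≤
      4 * N^3 * Real.exp (-(2*P)) := by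
  have hPp : (0:ℝ) < P := by exact_mod_cast hP
  set δ := Real.exp (-(2*P : ℝ)) with hδ
  have hδ0 : 0 < δ := Real.exp_pos _
  set v0 : ℝ := 8 * (2*P) * g^2 with hv0
  have hv0p : 0 < v0 := by positivity
  have half0 : (0:ℝ) ≤ 1/2 := by norm_num
  have half1 : (1/2:ℝ) ≤ 1 := by norm_num
  have key : ∀ ε', E (1/2) (fun ε => ind (8 * (2*P) * g < ‖Yf A (sz ε z) (sz ε' z')‖)) ≤
      (∑ c0, ind (v0 < ‖D1 A z (sz ε' z') c0‖^2) + ∑ b0, ind (v0 < ‖D2 A z (sz ε' z') b0‖^2)) + 2 * N^2 * δ := by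
    intro ε'
    by_cases hbad : (∃ c0, v0 < ‖D1 A z (sz ε' z') c0‖^2) ∨ (∃ b0, v0 < ‖D2 A z (sz ε' z') b0‖^2)
    · have i1 : E (1/2) (fun ε => ind (8 * (2*P) * g < ‖Yf A (sz ε z) (sz ε' z')‖)) ≤ 1 :=
        E_le_const half0 half1 fun _ => ind_le_one _
      have i2 := ind_or (∃ c0, v0 < ‖D1 A z (sz ε' z') c0‖^2) (∃ b0, v0 < ‖D2 A z (sz ε' z') b0‖^2)
      rw [ind_true hbad] at i2
      have i3 := ind_exists (fun c0 => v0 < ‖D1 A z (sz ε' z') c0‖^2)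
      have i4 := ind_exists (fun b0 => v0 < ‖D2 A z (sz ε' z') b0‖^2)
      have : 0 ≤ 2 * N^2 * δ := by positivity
      linarith
    · push Not at hbad
      obtain ⟨b1, b2⟩ := hbad
      have t := tail (Mi A z (sz ε' z')) v0 hv0p (by
          intro y
          rw [Mi_1]
          calc _ ≤ ∑ c0, v0 * ((fun b => y (b, c0)) ⬝ᵥ (fun b => y (b, c0))) := by
                apply Finset.sum_le_sum
                intro c0 _
                refine (le_nrm _ _).trans ?_
                exact mul_le_mul_of_nonneg_right (b1 c0) (Finset.sum_nonneg fun _ _ => mul_self_nonneg _)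
            _ = _ := by
                rw [← Finset.mul_sum]
                simp only [dotProduct, Fintype.sum_prod_type]
                rw [Finset.sum_comm]) (by
          intro y
          rw [Mi_2]
          calc _ ≤ ∑ b0, v0 * ((fun c => y (b0, c)) ⬝ᵥ (fun c => y (b0, c))) := by
                apply Finset.sum_le_sum
                intro c0 _
                refine (le_nrm _ _).trans ?_
                exact mul_le_mul_of_nonneg_right (b2 c0) (Finset.sum_nonneg fun _ _ => mul_self_nonneg _)
            _ = _ := by
                rw [← Finset.mul_sum]
                simp only [dotProduct, Fintype.sum_prod_type]) P hP
      have t2 : E (1/2) (fun ε => ind (8 * (2*P) * g < ‖Yf A (sz ε z) (sz ε' z')‖)) ≤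
          E (1/2) (fun ε => ind (8 * (2 * P) * v0 < ‖rad (Mi A z (sz ε' z')) ε‖^2)) := by
        apply E_mono half0 half1
        intro ε
        apply ind_mono
        intro hlt
        rw [rad_Mi]
        have : 8 * (2 * P) * v0 = (8 * (2*P) * g)^2 := by rw [hv0]; ring
        rw [this]
        exact pow_lt_pow_left₀ hlt (by positivity) two_ne_zero
      have t3 : ((Fintype.card (β × γ) : ℝ) + Fintype.card (β × γ)) ≤ 2 * N^2 := by
        rw [Fintype.card_prod]; push_cast
        have : (Fintype.card β : ℝ) * Fintype.card γ ≤ N * N := by gcongr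
        nlinarith
      have t4 : 0 ≤ ∑ c0, ind (v0 < ‖D1 A z (sz ε' z') c0‖^2) + ∑ b0, ind (v0 < ‖D2 A z (sz ε' z') b0‖^2) :=
        add_nonneg (Finset.sum_nonneg fun _ _ => ind_nonneg _) (Finset.sum_nonneg fun _ _ => ind_nonneg _)
      have t5 := mul_le_mul_of_nonneg_right t3 hδ0.le
      linarith
  refine (E_mono half0 half1 key).trans ?_
  rw [E_add, E_add, E_const, E_sum, E_sum]
  have s1 : ∑ c0, E (1/2) (fun ε' => ind (v0 < ‖D1 A z (sz ε' z') c0‖^2)) ≤ N * ((N*N+N) * δ) := by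
    calc _ ≤ ∑ c0 : γ, ((N*N+N) * δ) := by
          apply Finset.sum_le_sum
          intro c0 _
          refine (D1_tail A z z' c0 (g^2) (by positivity) (fun a c => h2 a c0 c) (fun b => h4 b c0) P hP).trans ?_
          gcongr
      _ = Fintype.card γ * ((N*N+N) * δ) := by simp
      _ ≤ _ := by gcongr
  have s2 : ∑ b0, E (1/2) (fun ε' => ind (v0 < ‖D2 A z (sz ε' z') b0‖^2)) ≤ N * ((N*N+N) * δ) := by
    calc _ ≤ ∑ b0 : β, ((N*N+N) * δ) := by
          apply Finset.sum_le_sum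
          intro b0 _
          refine (D2_tail A z z' b0 (g^2) (by positivity) (fun a c => h1 a b0 c) (fun c => h3 b0 c) P hP).trans ?_
          gcongr
      _ = Fintype.card β * ((N*N+N) * δ) := by simp
      _ ≤ _ := by gcongr
  have : 2 * N^3 + 4 * N^2 ≤ 4 * N^3 := by nlinarith [sq_nonneg N]
  have := mul_le_mul_of_nonneg_right this hδ0.le
  nlinarith

end Tens
end TC


namespace TC
open Matrix

noncomputable def bo (b : Bool) : ℝ := if b then 1 else 0

lemma bo_sq (b : Bool) : bo b ^ 2 = bo b := by cases b <;> simp [bo]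

section Chern
variable {ι κ : Type*} [Fintype ι] [DecidableEq ι] [Fintype κ]

lemma chern0 {p : ℝ} (h0 : 0 ≤ p) (h1 : p ≤ 1) (c : ι → ℝ) (Mx L : ℝ) (hM : 0 < Mx)
    (hc0 : ∀ i, 0 ≤ c i) (hc1 : ∀ i, c i ≤ Mx) :
    E p (fun ω => ind (2 * p * ∑ i, c i + Mx * L < ∑ i, c i * bo (ω i))) ≤ Real.exp (-L) := by
  have key : ∀ ω : ι → Bool, ind (2 * p * ∑ i, c i + Mx * L < ∑ i, c i * bo (ω i)) ≤
      Real.exp (-L) * ∏ i, (fun (i : ι) (b : Bool) => Real.exp ((c i * bo b - 2 * p * c i) / Mx)) i (ω i) := by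
    intro ω
    have e : Real.exp (-L) * ∏ i, (fun (i : ι) (b : Bool) => Real.exp ((c i * bo b - 2 * p * c i) / Mx)) i (ω i)
        = Real.exp ((∑ i, c i * bo (ω i) - (2 * p * ∑ i, c i + Mx * L)) / Mx) := by
      simp only
      rw [← Real.exp_sum, ← Real.exp_add, ← Finset.sum_div, Finset.sum_sub_distrib, ← Finset.mul_sum]
      congr 1
      field_simp
      ring
    rw [e]
    by_cases h : 2 * p * ∑ i, c i + Mx * L < ∑ i, c i * bo (ω i)
    · rw [ind_true h]
      apply Real.one_le_exp
      apply div_nonneg _ hM.le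
      linarith
    · rw [ind_false h]; positivity
  refine (E_mono h0 h1 key).trans ?_
  have ep := E_prod p (fun (i : ι) (b : Bool) => Real.exp ((c i * bo b - 2 * p * c i) / Mx))
  rw [E_mul]
  refine (mul_le_mul_of_nonneg_left (le_of_eq ep) (Real.exp_pos _).le).trans ?_
  have : ∏ i, (p * Real.exp ((c i * bo true - 2 * p * c i) / Mx) + (1 - p) * Real.exp ((c i * bo false - 2 * p * c i) / Mx)) ≤ 1 := by
    apply Finset.prod_le_one
    · intro i _
      have : 0 ≤ 1 - p := by linarith
      positivity
    · intro i _
      set x := c i / Mx with hx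
      have hx0 : 0 ≤ x := div_nonneg (hc0 i) hM.le
      have hx1 : x ≤ 1 := by rw [hx, div_le_one hM]; exact hc1 i
      have e1 : (c i * bo true - 2 * p * c i) / Mx = x + -(2 * p * x) := by
        rw [hx]; simp [bo]; ring
      have e2 : (c i * bo false - 2 * p * c i) / Mx = -(2 * p * x) := by
        rw [hx]; simp [bo]; ring
      rw [e1, e2, Real.exp_add]
      have a1 := Real.abs_exp_sub_one_le (x := x) (by rwa [abs_of_nonneg hx0])
      rw [abs_of_nonneg hx0] at a1
      have a2 := (abs_le.1 a1).2
      have a3 := Real.add_one_le_exp (2 * p * x)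
      have a4 : p * (Real.exp x - 1) ≤ p * (2 * x) := mul_le_mul_of_nonneg_left a2 h0
      have a5 : p * Real.exp x + (1 - p) ≤ Real.exp (2 * p * x) := by nlinarith
      have a6 := mul_le_mul_of_nonneg_right a5 (Real.exp_pos (-(2*p*x))).le
      rw [← Real.exp_add, add_neg_cancel, Real.exp_zero] at a6
      nlinarith
  nlinarith [Real.exp_pos (-L)]

lemma chern {p : ℝ} (h0 : 0 ≤ p) (h1 : p ≤ 1) (e : κ → ι) (he : Function.Injective e)
    (c : κ → ℝ) (Mx L s : ℝ) (hM : 0 < Mx)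
    (hc0 : ∀ i, 0 ≤ c i) (hc1 : ∀ i, c i ≤ Mx) (hs : 2 * p * ∑ k, c k ≤ s) :
    E p (fun ω => ind (s + Mx * L < ∑ k, c k * bo (ω (e k)))) ≤ Real.exp (-L) := by
  have hex : ∀ i, (∃ k, e k = i ∧ Function.extend e c 0 i = c k) ∨ Function.extend e c 0 i = 0 := by
    intro i
    by_cases h : ∃ k, e k = i
    · obtain ⟨k, rfl⟩ := h
      left; exact ⟨k, rfl, he.extend_apply _ _ _⟩
    · right; rw [Function.extend_apply' _ _ _ h]; rfl
  have hsum : ∀ f : ι → ℝ, ∑ i, Function.extend e c 0 i * f i = ∑ k, c k * f (e k) := by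
    intro f
    symm
    apply Finset.sum_of_injOn e he.injOn (by simp)
    · intro i _ hi
      rw [Function.extend_apply' _ _ _ (by simpa using hi)]
      simp
    · intro k _
      rw [he.extend_apply]
  have := chern0 h0 h1 (Function.extend e c 0) Mx L hM
    (by
      intro i
      rcases hex i with ⟨k, _, h⟩ | h <;> rw [h]
      exact hc0 k)
    (by
      intro i
      rcases hex i with ⟨k, _, h⟩ | h <;> rw [h]
      · exact hc1 k
      · exact hM.le)
  refine le_trans (E_mono h0 h1 fun ω => ind_mono ?_) this
  intro h
  rw [hsum]
  have := hsum (fun _ => 1)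
  simp only [mul_one] at this
  rw [this]
  linarith
end Chern

section Good

variable {α β γ : Type*} [Fintype α] [DecidableEq α] [Fintype β] [DecidableEq β] [Fintype γ] [DecidableEq γ]

structure Hyp (A : α → β → γ → ℝ) (p q M X X3 Y2 L n : ℝ) : Prop where
  p0 : 0 < p
  p1 : p ≤ 1
  pq : p * q = 1
  M0 : 0 < M
  X0 : 0 < X
  X30 : 0 ≤ X3
  L0 : 0 ≤ L
  hM : ∀ a b c, q^2 * (A a b c)^2 ≤ M
  hw : ∀ a b, 2 * q * ∑ c, (A a b c)^2 ≤ X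
  hw3 : ∀ a b, 2 * q * ∑ c, (A a b c)^2 ≤ X3
  hv : ∀ a c, 2 * q * ∑ b, (A a b c)^2 ≤ X
  hx : ∀ b c, 2 * q * ∑ a, (A a b c)^2 ≤ X
  hy : ∀ c, 2 * q * ∑ a, ∑ b, (A a b c)^2 ≤ Y2
  n0 : 2 ≤ n
  ca : Fintype.card α ≤ n
  cb : Fintype.card β ≤ n
  cc : Fintype.card γ ≤ n

noncomputable def qo (q : ℝ) (ω : α × β × γ → Bool) : α × β × γ → ℝ := fun i => q * bo (ω i)

def Good (A : α → β → γ → ℝ) (q S1 S2 : ℝ) (ω : α × β × γ → Bool) : Prop :=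
  (∀ a b, wS A (qo q ω) a b ≤ S1) ∧ (∀ a c, vS A (qo q ω) a c ≤ S1) ∧
  (∀ b c, xS A (qo q ω) b c ≤ S1) ∧ (∀ c, ∑ a, vS A (qo q ω) a c ≤ S2)

def Crs (A : α → β → γ → ℝ) (q S4 : ℝ) (ω τ : α × β × γ → Bool) : Prop :=
  ∀ b c, ∑ a, wS A (qo q ω) a b * vS A (qo q τ) a c ≤ S4

lemma sum_ind_le {κ ι : Type*} [Fintype κ] [Fintype ι] [DecidableEq ι] {p : ℝ} (h0 : 0 ≤ p) (h1 : p ≤ 1)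
    (f : κ → (ι → Bool) → Prop) (δ : ℝ) (h : ∀ k, E p (fun ω => ind (f k ω)) ≤ δ) :
    E p (fun ω => ind (∃ k, f k ω)) ≤ Fintype.card κ * δ := by
  calc _ ≤ E p (fun ω => ∑ k, ind (f k ω)) := E_mono h0 h1 fun ω => ind_exists _
    _ = ∑ k, E p (fun ω => ind (f k ω)) := E_sum _ _ _
    _ ≤ ∑ k : κ, δ := Finset.sum_le_sum fun k _ => h k
    _ = _ := by simp

lemma good_prob {A : α → β → γ → ℝ} {p q M X X3 Y2 L n : ℝ} (H : Hyp A p q M X X3 Y2 L n) :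
    E p (fun ω => ind (¬ Good A q (X + M * L) (Y2 + M * L) ω)) ≤ 4 * n^2 * Real.exp (-L) := by
  have h0 := H.p0.le
  have h1 := H.p1
  have hq : p * q^2 = q := by rw [pow_two, ← mul_assoc, H.pq, one_mul]
  have t : ∀ s : ℝ, 2 * p * (q^2 * s) = 2 * q * s := by
    intro s
    calc _ = 2 * (p * q^2) * s := by ring
      _ = _ := by rw [hq]
  have n0 : 0 ≤ n := by linarith [H.n0]
  have c1 : E p (fun ω => ind (∃ k : α × β, X + M * L < wS A (qo q ω) k.1 k.2)) ≤ Fintype.card (α × β) * Real.exp (-L) := by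
    apply sum_ind_le h0 h1
    rintro ⟨a, b⟩
    have := chern h0 h1 (fun c : γ => (a, b, c)) (fun c c' h => by simpa using h) (fun c => q^2 * (A a b c)^2) M L X H.M0
      (fun c => by positivity) (fun c => H.hM a b c) (by rw [← Finset.mul_sum, t]; exact H.hw a b)
    refine le_trans (le_of_eq ?_) this
    congr 1; funext ω; congr 2
    simp only [wS, qo]
    exact Finset.sum_congr rfl fun c _ => by rw [mul_pow, mul_pow, bo_sq]; ring
  have c2 : E p (fun ω => ind (∃ k : α × γ, X + M * L < vS A (qo q ω) k.1 k.2)) ≤ Fintype.card (α × γ) * Real.exp (-L) := by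
    apply sum_ind_le h0 h1
    rintro ⟨a, c⟩
    have := chern h0 h1 (fun b : β => (a, b, c)) (fun c c' h => by simpa using h) (fun b => q^2 * (A a b c)^2) M L X H.M0
      (fun c => by positivity) (fun b => H.hM a b c) (by rw [← Finset.mul_sum, t]; exact H.hv a c)
    refine le_trans (le_of_eq ?_) this
    congr 1; funext ω; congr 2
    simp only [vS, qo]
    exact Finset.sum_congr rfl fun c _ => by rw [mul_pow, mul_pow, bo_sq]; ring
  have c3 : E p (fun ω => ind (∃ k : β × γ, X + M * L < xS A (qo q ω) k.1 k.2)) ≤ Fintype.card (β × γ) * Real.exp (-L) := by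
    apply sum_ind_le h0 h1
    rintro ⟨b, c⟩
    have := chern h0 h1 (fun a : α => (a, b, c)) (fun c c' h => by simpa using h) (fun a => q^2 * (A a b c)^2) M L X H.M0
      (fun c => by positivity) (fun a => H.hM a b c) (by rw [← Finset.mul_sum, t]; exact H.hx b c)
    refine le_trans (le_of_eq ?_) this
    congr 1; funext ω; congr 2
    simp only [xS, qo]
    exact Finset.sum_congr rfl fun c _ => by rw [mul_pow, mul_pow, bo_sq]; ring
  have c4 : E p (fun ω => ind (∃ c : γ, Y2 + M * L < ∑ a, vS A (qo q ω) a c)) ≤ Fintype.card γ * Real.exp (-L) := by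
    apply sum_ind_le h0 h1
    intro c
    have := chern h0 h1 (fun k : α × β => (k.1, k.2, c)) (fun k k' h => by
        simp only [Prod.mk.injEq] at h; exact Prod.ext h.1 h.2.1) (fun k => q^2 * (A k.1 k.2 c)^2) M L Y2 H.M0
      (fun c => by positivity) (fun k => H.hM k.1 k.2 c)
      (by rw [← Finset.mul_sum, t, Fintype.sum_prod_type]; exact H.hy c)
    refine le_trans (le_of_eq ?_) this
    congr 1; funext ω; congr 2
    simp only [vS, qo, Fintype.sum_prod_type]
    exact Finset.sum_congr rfl fun a _ => Finset.sum_congr rfl fun c _ => by rw [mul_pow, mul_pow, bo_sq]; ring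
  have hk : ∀ ω, ind (¬ Good A q (X + M * L) (Y2 + M * L) ω) ≤
      (ind (∃ k : α × β, X + M * L < wS A (qo q ω) k.1 k.2) + ind (∃ k : α × γ, X + M * L < vS A (qo q ω) k.1 k.2))
      + (ind (∃ k : β × γ, X + M * L < xS A (qo q ω) k.1 k.2) + ind (∃ c : γ, Y2 + M * L < ∑ a, vS A (qo q ω) a c)) := by
    intro ω
    refine le_trans (ind_mono ?_) ((ind_or _ _).trans (add_le_add (ind_or _ _) (ind_or _ _)))
    intro h
    by_contra hc
    push Not at hc
    obtain ⟨⟨x1, x2⟩, x3, x4⟩ := hc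
    exact h ⟨fun a b => x1 (a, b), fun a c => x2 (a, c), fun b c => x3 (b, c), x4⟩
  refine (E_mono h0 h1 hk).trans ?_
  rw [E_add, E_add, E_add]
  rw [Fintype.card_prod] at c1 c2 c3
  push_cast at c1 c2 c3
  have d1 : (Fintype.card α : ℝ) * Fintype.card β ≤ n * n := by gcongr <;> first | exact H.ca | exact H.cb
  have d2 : (Fintype.card α : ℝ) * Fintype.card γ ≤ n * n := by gcongr <;> first | exact H.ca | exact H.cc
  have d3 : (Fintype.card β : ℝ) * Fintype.card γ ≤ n * n := by gcongr <;> first | exact H.cb | exact H.cc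
  have d4 : (Fintype.card γ : ℝ) ≤ n * n := by nlinarith [H.cc, H.n0]
  have hδ := (Real.exp_pos (-L)).le
  have := mul_le_mul_of_nonneg_right d1 hδ
  have := mul_le_mul_of_nonneg_right d2 hδ
  have := mul_le_mul_of_nonneg_right d3 hδ
  have := mul_le_mul_of_nonneg_right d4 hδ
  linarith

lemma crs_prob {A : α → β → γ → ℝ} {p q M X X3 Y2 L n : ℝ} (H : Hyp A p q M X X3 Y2 L n) {S1 S2 : ℝ} (hS1 : 0 < S1)
    (τ : α × β × γ → Bool) :
    E p (fun ω => ind (Good A q S1 S2 τ ∧ ¬ Crs A q (X3 * S2 + M * S1 * L) ω τ)) ≤ n^2 * Real.exp (-L) := by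
  have h0 := H.p0.le
  have h1 := H.p1
  have n0 : 0 ≤ n := by linarith [H.n0]
  have hδ := (Real.exp_pos (-L)).le
  by_cases hg : Good A q S1 S2 τ
  · have c1 : E p (fun ω => ind (∃ k : β × γ, X3 * S2 + M * S1 * L < ∑ a, wS A (qo q ω) a k.1 * vS A (qo q τ) a k.2))
        ≤ Fintype.card (β × γ) * Real.exp (-L) := by
      apply sum_ind_le h0 h1
      rintro ⟨b, c⟩
      have hV0 := fun a => vS_nonneg A (qo q τ) a c
      have := chern h0 h1 (fun k : α × γ => (k.1, b, k.2)) (fun k k' h => by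
          simp only [Prod.mk.injEq] at h; exact Prod.ext h.1 h.2.2)
        (fun k => (q^2 * (A k.1 b k.2)^2) * vS A (qo q τ) k.1 c) (M * S1) L (X3 * S2) (mul_pos H.M0 hS1)
        (fun k => mul_nonneg (by positivity) (hV0 _))
        (fun k => mul_le_mul (H.hM _ _ _) (hg.2.1 _ _) (hV0 _) H.M0.le)
        (by
          rw [Fintype.sum_prod_type]
          have : ∀ a, 2 * p * ∑ c', (q^2 * (A a b c')^2) * vS A (qo q τ) a c ≤ X3 * vS A (qo q τ) a c := by
            intro a
            rw [← Finset.sum_mul, ← mul_assoc]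
            apply mul_le_mul_of_nonneg_right _ (hV0 a)
            refine le_trans (le_of_eq ?_) (H.hw3 a b)
            rw [← Finset.mul_sum]
            have := H.pq
            linear_combination (2 * q * ∑ c', (A a b c')^2) * this
          rw [Finset.mul_sum]
          refine (Finset.sum_le_sum fun a _ => this a).trans ?_
          rw [← Finset.mul_sum]
          exact mul_le_mul_of_nonneg_left (hg.2.2.2 c) H.X30)
      refine le_trans (le_of_eq ?_) this
      congr 1; funext ω; congr 2
      rw [Fintype.sum_prod_type]
      apply Finset.sum_congr rfl
      intro a _
      simp only [wS]
      rw [Finset.sum_mul]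
      exact Finset.sum_congr rfl fun c' _ => by simp only [qo]; rw [mul_pow, mul_pow, bo_sq]; ring
    rw [Fintype.card_prod] at c1
    push_cast at c1
    have d3 : (Fintype.card β : ℝ) * Fintype.card γ ≤ n * n := by gcongr <;> first | exact H.cb | exact H.cc
    have := mul_le_mul_of_nonneg_right d3 hδ
    have e : E p (fun ω => ind (Good A q S1 S2 τ ∧ ¬ Crs A q (X3 * S2 + M * S1 * L) ω τ)) ≤
        E p (fun ω => ind (∃ k : β × γ, X3 * S2 + M * S1 * L < ∑ a, wS A (qo q ω) a k.1 * vS A (qo q τ) a k.2)) := by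
      apply E_mono h0 h1
      intro ω
      apply ind_mono
      rintro ⟨_, h⟩
      by_contra hc
      push Not at hc
      exact h fun b c => hc (b, c)
    linarith
  · have : ∀ ω, ind (Good A q S1 S2 τ ∧ ¬ Crs A q (X3 * S2 + M * S1 * L) ω τ) ≤ 0 := fun ω => by
      rw [ind_false (fun h => hg h.1)]
    refine (E_le_const h0 h1 this).trans (by positivity)

end Good
end TC


namespace TC
open Matrix
open scoped Matrix.Norms.L2Operator

section Sym

variable {α β γ : Type*} [Fintype α] [DecidableEq α] [Fintype β] [DecidableEq β] [Fintype γ] [DecidableEq γ]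

noncomputable def ze (q : ℝ) (ω ω' : α × β × γ → Bool) : α × β × γ → ℝ := fun i => q * (bo (ω i) - bo (ω' i))

lemma sz_ze (q : ℝ) (ε ω ω' : α × β × γ → Bool) : sz ε (ze q ω ω') = ze q (mix ε ω ω') (mix ε ω' ω) := by
  funext i
  simp only [sz, ze, mix]
  by_cases h : ε i
  · simp [h, sg]
  · simp [h, sg]; ring

lemma ze_sq (q : ℝ) (ω ω' : α × β × γ → Bool) (i : α × β × γ) (x : ℝ) :
    (ze q ω ω' i * x)^2 ≤ (qo q ω i * x)^2 + (qo q ω' i * x)^2 := by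
  simp only [ze, qo]
  have h1 : 0 ≤ bo (ω i) := by unfold bo; split_ifs <;> norm_num
  have h2 : 0 ≤ bo (ω' i) := by unfold bo; split_ifs <;> norm_num
  have h3 : 0 ≤ (q * x)^2 * (bo (ω i) * bo (ω' i)) := by positivity
  nlinarith

lemma wS_ze (A : α → β → γ → ℝ) (q : ℝ) (ω ω' : α × β × γ → Bool) (a b) :
    wS A (ze q ω ω') a b ≤ wS A (qo q ω) a b + wS A (qo q ω') a b := by
  simp only [wS, ← Finset.sum_add_distrib]
  exact Finset.sum_le_sum fun _ _ => ze_sq _ _ _ _ _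
lemma vS_ze (A : α → β → γ → ℝ) (q : ℝ) (ω ω' : α × β × γ → Bool) (a c) :
    vS A (ze q ω ω') a c ≤ vS A (qo q ω) a c + vS A (qo q ω') a c := by
  simp only [vS, ← Finset.sum_add_distrib]
  exact Finset.sum_le_sum fun _ _ => ze_sq _ _ _ _ _
lemma xS_ze (A : α → β → γ → ℝ) (q : ℝ) (ω ω' : α × β × γ → Bool) (b c) :
    xS A (ze q ω ω') b c ≤ xS A (qo q ω) b c + xS A (qo q ω') b c := by
  simp only [xS, ← Finset.sum_add_distrib]
  exact Finset.sum_le_sum fun _ _ => ze_sq _ _ _ _ _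

lemma symm_ins (p q : ℝ) (G : (α × β × γ → ℝ) → ℝ) :
    E p (fun ω => E p (fun ω' => G (ze q ω ω'))) =
      E p (fun ω => E p (fun ω' => E (1/2) (fun ε => G (sz ε (ze q ω ω'))))) := by
  have h : ∀ ε : α × β × γ → Bool, E p (fun ω => E p (fun ω' => G (sz ε (ze q ω ω')))) =
      E p (fun ω => E p (fun ω' => G (ze q ω ω'))) := by
    intro ε
    simp only [sz_ze]
    exact E_mix p ε (fun ω ω' => G (ze q ω ω'))
  have h2 : E p (fun ω => E p (fun ω' => G (ze q ω ω'))) =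
      E (1/2) (fun ε => E p (fun ω => E p (fun ω' => G (sz ε (ze q ω ω'))))) := by
    simp only [h, E_const]
  rw [h2]
  rw [E_comm]
  congr 1; funext ω
  rw [E_comm]

def Rm (A : α → β → γ → ℝ) (z : α × β × γ → ℝ) (b : β) : Matrix α γ ℝ :=
  of fun a c => z (a, b, c) * A a b c

lemma R_main {A : α → β → γ → ℝ} {p q M X X3 Y2 n : ℝ} {P : ℕ} (hP : 1 ≤ P)
    (H : Hyp A p q M X X3 Y2 (2*P) n) {g : ℝ} (hg : 0 < g) (hg1 : 2 * (X + M * (2*P)) ≤ g) (b : β) :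
    E p (fun ω => E p (fun ω' => ind (8 * (2*P) * g < ‖Rm A (ze q ω ω') b‖^2))) ≤
      (8 * n^2 + 2 * n) * Real.exp (-(2*P)) := by
  have h0 := H.p0.le
  have h1 := H.p1
  have hδ := (Real.exp_pos (-(2*P : ℝ))).le
  set S1 := X + M * (2*P) with hS1
  set S2 := Y2 + M * (2*P) with hS2
  rw [symm_ins p q (fun z => ind (8 * (2*P) * g < ‖Rm A z b‖^2))]
  have key : ∀ ω ω', E (1/2) (fun ε => ind (8 * (2*P) * g < ‖Rm A (sz ε (ze q ω ω')) b‖^2)) ≤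
      (ind (¬ Good A q S1 S2 ω) + ind (¬ Good A q S1 S2 ω')) + (2 * n) * Real.exp (-(2*P)) := by
    intro ω ω'
    have hn : 0 ≤ (2 * n) * Real.exp (-(2*P : ℝ)) := by
      have := H.n0
      positivity
    have i1 : E (1/2) (fun ε => ind (8 * (2*P) * g < ‖Rm A (sz ε (ze q ω ω')) b‖^2)) ≤ 1 :=
      E_le_const (by norm_num) (by norm_num) fun _ => ind_le_one _
    by_cases g1 : Good A q S1 S2 ω
    swap
    · rw [ind_true g1]
      linarith [ind_nonneg (¬ Good A q S1 S2 ω')]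
    by_cases g2 : Good A q S1 S2 ω'
    swap
    · rw [ind_true g2]
      linarith [ind_nonneg (¬ Good A q S1 S2 ω)]
    have h := tail_entries (ι := α × β × γ) (fun (k : α) (l : γ) => (k, b, l))
      (fun k l k' l' h => by simp only [Prod.mk.injEq] at h; exact ⟨h.1, h.2.2⟩)
      (fun a c => ze q ω ω' (a, b, c) * A a b c) g hg
      (by
        intro a
        have := wS_ze A q ω ω' a b
        have := g1.1 a b
        have := g2.1 a b
        simp only [wS] at *
        linarith)
      (by
        intro c
        have := xS_ze A q ω ω' b c
        have := g1.2.2.1 b c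
        have := g2.2.2.1 b c
        simp only [xS] at *
        linarith) P hP
    have e : E (1/2) (fun ε => ind (8 * (2*P) * g < ‖Rm A (sz ε (ze q ω ω')) b‖^2)) ≤
        (Fintype.card α + Fintype.card γ) * Real.exp (-(2*P)) := by
      refine le_trans (le_of_eq ?_) h
      congr 1; funext ε
      congr 4
      ext k l
      simp only [Rm, sz, of_apply]; ring
    have := ind_nonneg (¬ Good A q S1 S2 ω)
    have := ind_nonneg (¬ Good A q S1 S2 ω')
    have : ((Fintype.card α : ℝ) + Fintype.card γ) ≤ 2 * n := by linarith [H.ca, H.cc]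
    have := mul_le_mul_of_nonneg_right this hδ
    linarith
  refine (E_mono h0 h1 fun ω => E_mono h0 h1 fun ω' => key ω ω').trans ?_
  simp only [E_add, E_const]
  have := good_prob H
  simp only [← hS1, ← hS2] at this
  linarith

lemma Y_main {A : α → β → γ → ℝ} {p q M X X3 Y2 n : ℝ} {P : ℕ} (hP : 1 ≤ P)
    (H : Hyp A p q M X X3 Y2 (2*P) n) {g : ℝ} (hg : 0 < g) (hg1 : 2 * (X + M * (2*P)) ≤ g)
    (hg2 : 4 * (X3 * (Y2 + M * (2*P)) + M * (X + M * (2*P)) * (2*P)) ≤ g^2) :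
    E p (fun ω => E p (fun ω' => E p (fun τ => E p (fun τ' =>
      ind (8 * (2*P) * g < ‖Yf A (ze q ω ω') (ze q τ τ')‖))))) ≤
      (24 * n^2 + 4 * n^3) * Real.exp (-(2*P)) := by
  have h0 := H.p0.le
  have h1 := H.p1
  have hPp : (0:ℝ) < P := by exact_mod_cast hP
  have hδ := (Real.exp_pos (-(2*P : ℝ))).le
  set S1 := X + M * (2*P) with hS1
  set S2 := Y2 + M * (2*P) with hS2
  set S4 := X3 * S2 + M * S1 * (2*P) with hS4
  have hS1p : 0 < S1 := by have := H.X0; have := H.M0; positivity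
  have e1 : E p (fun ω => E p (fun ω' => E p (fun τ => E p (fun τ' =>
      ind (8 * (2*P) * g < ‖Yf A (ze q ω ω') (ze q τ τ')‖))))) =
     E p (fun ω => E p (fun ω' => E p (fun τ => E p (fun τ' =>
      E (1/2) (fun ε' => E (1/2) (fun ε => ind (8 * (2*P) * g < ‖Yf A (sz ε (ze q ω ω')) (sz ε' (ze q τ τ'))‖))))))) := by
    rw [symm_ins p q (fun z => E p (fun τ => E p (fun τ' =>
      ind (8 * (2*P) * g < ‖Yf A z (ze q τ τ')‖))))]
    congr 1; funext ω; congr 1; funext ω'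
    rw [E_comm]
    have : ∀ τ, E (1/2) (fun ε => E p (fun τ' => ind (8 * (2*P) * g < ‖Yf A (sz ε (ze q ω ω')) (ze q τ τ')‖))) =
       E p (fun τ' => E (1/2) (fun ε => ind (8 * (2*P) * g < ‖Yf A (sz ε (ze q ω ω')) (ze q τ τ')‖))) :=
      fun τ => E_comm _ _ _
    simp only [this]
    exact symm_ins p q (fun z' => E (1/2) (fun ε => ind (8 * (2*P) * g < ‖Yf A (sz ε (ze q ω ω')) z'‖)))
  rw [e1]
  let bG : (α × β × γ → Bool) → ℝ := fun ω => ind (¬ Good A q S1 S2 ω)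
  let bC : (α × β × γ → Bool) → (α × β × γ → Bool) → ℝ := fun ω τ => ind (Good A q S1 S2 τ ∧ ¬ Crs A q S4 ω τ)
  have bG0 : ∀ ω, 0 ≤ bG ω := fun ω => ind_nonneg _
  have bC0 : ∀ ω τ, 0 ≤ bC ω τ := fun ω τ => ind_nonneg _
  have key : ∀ ω ω' τ τ', E (1/2) (fun ε' => E (1/2) (fun ε =>
        ind (8 * (2*P) * g < ‖Yf A (sz ε (ze q ω ω')) (sz ε' (ze q τ τ'))‖))) ≤
      (bG ω + bG ω' + bG τ + bG τ') + (bC ω τ + bC ω τ' + bC ω' τ + bC ω' τ')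
       + (bC τ ω + bC τ ω' + bC τ' ω + bC τ' ω') + 4 * n^3 * Real.exp (-(2*P)) := by
    intro ω ω' τ τ'
    have hn : 0 ≤ 4 * n^3 * Real.exp (-(2*P : ℝ)) := by
      have := H.n0
      positivity
    have i1 : E (1/2) (fun ε' => E (1/2) (fun ε =>
        ind (8 * (2*P) * g < ‖Yf A (sz ε (ze q ω ω')) (sz ε' (ze q τ τ'))‖))) ≤ 1 :=
      E_le_const (by norm_num) (by norm_num) fun _ => E_le_const (by norm_num) (by norm_num) fun _ => ind_le_one _
    have p1 := bG0 ω
    have p2 := bG0 ω'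
    have p3 := bG0 τ
    have p4 := bG0 τ'
    have c1 := bC0 ω τ
    have c2 := bC0 ω τ'
    have c3 := bC0 ω' τ
    have c4 := bC0 ω' τ'
    have c5 := bC0 τ ω
    have c6 := bC0 τ ω'
    have c7 := bC0 τ' ω
    have c8 := bC0 τ' ω'
    have bGt : ∀ ω, ¬ Good A q S1 S2 ω → bG ω = 1 := fun ω h => ind_true h
    have bCt : ∀ ω τ, Good A q S1 S2 τ → ¬ Crs A q S4 ω τ → bC ω τ = 1 := fun ω τ h h' => ind_true ⟨h, h'⟩
    by_cases g1 : Good A q S1 S2 ω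
    swap
    · have := bGt _ g1; linarith
    by_cases g2 : Good A q S1 S2 ω'
    swap
    · have := bGt _ g2; linarith
    by_cases g3 : Good A q S1 S2 τ
    swap
    · have := bGt _ g3; linarith
    by_cases g4 : Good A q S1 S2 τ'
    swap
    · have := bGt _ g4; linarith
    by_cases k1 : Crs A q S4 ω τ
    swap
    · have := bCt _ _ g3 k1; linarith
    by_cases k2 : Crs A q S4 ω τ'
    swap
    · have := bCt _ _ g4 k2; linarith
    by_cases k3 : Crs A q S4 ω' τ
    swap
    · have := bCt _ _ g3 k3; linarith
    by_cases k4 : Crs A q S4 ω' τ'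
    swap
    · have := bCt _ _ g4 k4; linarith
    by_cases k5 : Crs A q S4 τ ω
    swap
    · have := bCt _ _ g1 k5; linarith
    by_cases k6 : Crs A q S4 τ ω'
    swap
    · have := bCt _ _ g2 k6; linarith
    by_cases k7 : Crs A q S4 τ' ω
    swap
    · have := bCt _ _ g1 k7; linarith
    by_cases k8 : Crs A q S4 τ' ω'
    swap
    · have := bCt _ _ g2 k8; linarith
    have cross : ∀ σ σ' ρ ρ', Crs A q S4 σ ρ → Crs A q S4 σ ρ' → Crs A q S4 σ' ρ → Crs A q S4 σ' ρ' →
        ∀ b c, ∑ a, wS A (ze q σ σ') a b * vS A (ze q ρ ρ') a c ≤ g^2 := by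
      intro σ σ' ρ ρ' x1 x2 x3 x4 b c
      have y1 := x1 b c
      have y2 := x2 b c
      have y3 := x3 b c
      have y4 := x4 b c
      have : ∑ a, wS A (ze q σ σ') a b * vS A (ze q ρ ρ') a c ≤
          ∑ a, (wS A (qo q σ) a b * vS A (qo q ρ) a c + wS A (qo q σ) a b * vS A (qo q ρ') a c +
            (wS A (qo q σ') a b * vS A (qo q ρ) a c + wS A (qo q σ') a b * vS A (qo q ρ') a c)) := by
        apply Finset.sum_le_sum
        intro a _
        have := mul_le_mul (wS_ze A q σ σ' a b) (vS_ze A q ρ ρ' a c) (vS_nonneg _ _ _ _)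
          (add_nonneg (wS_nonneg _ _ _ _) (wS_nonneg _ _ _ _))
        linarith
      simp only [Finset.sum_add_distrib] at this
      linarith
    have w1 : ∀ σ σ', Good A q S1 S2 σ → Good A q S1 S2 σ' → ∀ a b, wS A (ze q σ σ') a b ≤ g := by
      intro σ σ' x1 x2 a b
      linarith [wS_ze A q σ σ' a b, x1.1 a b, x2.1 a b]
    have v1 : ∀ σ σ', Good A q S1 S2 σ → Good A q S1 S2 σ' → ∀ a b, vS A (ze q σ σ') a b ≤ g := by
      intro σ σ' x1 x2 a b
      linarith [vS_ze A q σ σ' a b, x1.2.1 a b, x2.2.1 a b]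
    have := Y_sign A (ze q ω ω') (ze q τ τ') g hg
      (fun a b b' => by
        rw [pow_two]
        exact mul_le_mul (w1 _ _ g1 g2 _ _) (w1 _ _ g3 g4 _ _) (wS_nonneg _ _ _ _) hg.le)
      (fun a b b' => by
        rw [pow_two]
        exact mul_le_mul (v1 _ _ g1 g2 _ _) (v1 _ _ g3 g4 _ _) (vS_nonneg _ _ _ _) hg.le)
      (fun b c => cross _ _ _ _ k1 k2 k3 k4 b c)
      (fun b c => by
        have := cross _ _ _ _ k5 k6 k7 k8 b c
        refine le_trans (le_of_eq ?_) this
        exact Finset.sum_congr rfl fun a _ => mul_comm _ _) P hP n H.ca H.cb H.cc H.n0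
    linarith
  refine (E_mono h0 h1 fun ω => E_mono h0 h1 fun ω' => E_mono h0 h1 fun τ => E_mono h0 h1 fun τ' => key ω ω' τ τ').trans ?_
  have x1 : E p bG ≤ 4 * n^2 * Real.exp (-(2*P)) := good_prob H
  have x2 : ∀ τ, E p (fun ω => bC ω τ) ≤ n^2 * Real.exp (-(2*P)) := fun τ => crs_prob H hS1p τ
  have x3 : E p (fun τ => E p (fun ω => bC ω τ)) ≤ n^2 * Real.exp (-(2*P)) := E_le_const h0 h1 x2
  have x4 : E p (fun ω => E p (fun τ => bC ω τ)) ≤ n^2 * Real.exp (-(2*P)) := by rw [E_comm]; exact x3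
  simp only [E_add, E_const]
  change (E p bG + E p bG + E p bG + E p bG) + _ + _ + _ ≤ _
  linarith

end Sym
end TC


namespace TC
open Matrix
open scoped Matrix.Norms.L2Operator

section Coord
variable {ι : Type*} [Fintype ι] [DecidableEq ι]

lemma E_one (p : ℝ) (i : ι) (f : Bool → ℝ) :
    E p (fun ω : ι → Bool => f (ω i)) = p * f true + (1 - p) * f false := by
  have h := E_prod p (fun (k : ι) b => if k = i then f b else 1)
  rw [Fintype.prod_eq_single i (by intro k hk; simp [hk])] at h
  simp only [if_true] at h
  rw [← h]
  congr 1; funext ω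
  rw [Fintype.prod_eq_single i (by intro k hk; simp [hk])]
  simp

lemma E_two (p : ℝ) (i j : ι) (hij : i ≠ j) (f g : Bool → ℝ) :
    E p (fun ω : ι → Bool => f (ω i) * g (ω j)) = (p * f true + (1 - p) * f false) * (p * g true + (1 - p) * g false) := by
  have h := E_prod p (fun (k : ι) b => if k = i then f b else if k = j then g b else 1)
  rw [Fintype.prod_eq_mul i j hij (by intro k hk; simp [hk.1, hk.2])] at h
  simp only [if_true, hij.symm, if_false] at h
  rw [← h]
  congr 1; funext ω
  rw [Fintype.prod_eq_mul i j hij (by intro k hk; simp [hk.1, hk.2])]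
  simp [hij.symm]

lemma markov (F u K t : ℝ) (hu : 0 < u) (hK : 0 ≤ K * t) (h : F ≤ u + K * u * t) : ind (2 * u < F) ≤ K * t := by
  apply ind_le hK
  intro h2
  by_contra hc
  push Not at hc
  nlinarith

lemma split_ind (G u K : ℝ) (h : G ≤ K * u) (hu : 0 < u) : G ≤ u + K * u * ind (u < G) := by
  by_cases hG : u < G
  · rw [ind_true hG]; linarith
  · rw [ind_false hG]; linarith

end Coord

section Nrm
variable {m n : Type*} [Fintype m] [DecidableEq m] [Fintype n] [DecidableEq n]

lemma nrm_entry (M : Matrix m n ℝ) (s : ℝ) (hs : 0 ≤ s) (h : ∀ i j, (M i j)^2 ≤ s^2) (t : ℝ) (ht : 0 ≤ t)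
    (hc : (Fintype.card m : ℝ) * Fintype.card n ≤ t^2) : ‖M‖ ≤ t * s := by
  apply nrm_le _ _ (by positivity)
  intro y
  have hy : 0 ≤ y ⬝ᵥ y := Finset.sum_nonneg fun _ _ => mul_self_nonneg _
  have hrow : ∀ i, (M *ᵥ y) i * (M *ᵥ y) i ≤ (Fintype.card n * s^2) * (y ⬝ᵥ y) := by
    intro i
    simp only [mulVec, dotProduct, ← sq]
    refine (Finset.sum_mul_sq_le_sq_mul_sq _ _ _).trans ?_
    apply mul_le_mul_of_nonneg_right _ (Finset.sum_nonneg fun _ _ => sq_nonneg _)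
    refine (Finset.sum_le_sum fun j _ => h i j).trans ?_
    simp
  calc (M *ᵥ y) ⬝ᵥ (M *ᵥ y) = ∑ i, (M *ᵥ y) i * (M *ᵥ y) i := rfl
    _ ≤ ∑ i : m, (Fintype.card n * s^2) * (y ⬝ᵥ y) := Finset.sum_le_sum fun i _ => hrow i
    _ = (Fintype.card m * Fintype.card n) * (s^2 * (y ⬝ᵥ y)) := by simp; ring
    _ ≤ t^2 * (s^2 * (y ⬝ᵥ y)) := by gcongr
    _ = _ := by ring

end Nrm

section Dec

variable {α β γ : Type*} [Fintype α] [DecidableEq α] [Fintype β] [DecidableEq β] [Fintype γ] [DecidableEq γ]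

noncomputable def xi (q : ℝ) (ω : α × β × γ → Bool) : α × β × γ → ℝ := fun i => q * bo (ω i) - 1

lemma ze_eq (q : ℝ) (ω ω' : α × β × γ → Bool) (i) : ze q ω ω' i = xi q ω i - xi q ω' i := by
  simp only [ze, xi]; ring

lemma ze_abs (q : ℝ) (ω ω' : α × β × γ → Bool) (i) : (ze q ω ω' i)^2 ≤ q^2 := by
  simp only [ze, bo, mul_pow]
  have : 0 ≤ q^2 := sq_nonneg q
  split_ifs <;> norm_num <;> assumption

lemma E_ze (p q : ℝ) (hpq : p * q = 1) (ω : α × β × γ → Bool) (i) : E p (fun ω' => ze q ω ω' i) = xi q ω i := by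
  simp only [ze_eq]
  rw [E_sub, E_const]
  have := E_one p i (fun b => q * bo b - 1)
  simp only [xi]
  rw [this]
  simp only [bo, if_true]
  norm_num
  linear_combination hpq

lemma E_ze2 (p q : ℝ) (hpq : p * q = 1) (ω : α × β × γ → Bool) (i j) (hij : i ≠ j) :
    E p (fun ω' => ze q ω ω' i * ze q ω ω' j) = xi q ω i * xi q ω j := by
  simp only [ze_eq, xi]
  rw [E_two p i j hij (fun b => q * bo (ω i) - 1 - (q * bo b - 1)) (fun b => q * bo (ω j) - 1 - (q * bo b - 1))]
  have bt : bo true = 1 := rfl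
  have bf : bo false = 0 := rfl
  have e : ∀ s : ℝ, p * (q * s - 1 - (q * bo true - 1)) + (1 - p) * (q * s - 1 - (q * bo false - 1)) = q * s - 1 := by
    intro s
    rw [bt, bf]
    linear_combination (-1) * hpq
  rw [e, e]

lemma R_desym {A : α → β → γ → ℝ} {p q M X X3 Y2 n : ℝ} {P : ℕ} (hP : 1 ≤ P)
    (H : Hyp A p q M X X3 Y2 (2*P) n) {g : ℝ} (hg : 0 < g) (hg1 : 2 * (X + M * (2*P)) ≤ g)
    (u : ℝ) (hu : 0 < u) (hMu : M ≤ u^2) (hgu : 8 * (2*P) * g ≤ u^2) (b : β) :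
    E p (fun ω => ind (2 * u < ‖Rm A (xi q ω) b‖)) ≤ n * ((8 * n^2 + 2 * n) * Real.exp (-(2*P))) := by
  have h0 := H.p0.le
  have h1 := H.p1
  have n0 : 0 ≤ n := by linarith [H.n0]
  have bd : ∀ ω ω', ‖Rm A (ze q ω ω') b‖ ≤ n * u := by
    intro ω ω'
    apply nrm_entry _ u hu.le _ n n0
    · rw [pow_two]
      have := H.ca
      have := H.cc
      gcongr
    · intro a c
      simp only [Rm, of_apply, mul_pow]
      refine le_trans ?_ hMu
      refine le_trans ?_ (H.hM a b c)
      exact mul_le_mul_of_nonneg_right (ze_abs _ _ _ _) (sq_nonneg _)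
  have key : ∀ ω, ind (2 * u < ‖Rm A (xi q ω) b‖) ≤ n * E p (fun ω' => ind (u < ‖Rm A (ze q ω ω') b‖)) := by
    intro ω
    apply markov _ _ _ _ hu
    · exact mul_nonneg n0 (E_nonneg h0 h1 fun _ => ind_nonneg _)
    · have e : Rm A (xi q ω) b = E p (fun ω' => Rm A (ze q ω ω') b) := by
        ext a c
        rw [E_apply]
        simp only [Rm, of_apply]
        simp only [mul_comm _ (A a b c)]
        rw [E_mul, E_ze p q H.pq]
      rw [e]
      refine (norm_E_le h0 h1 _).trans ?_
      refine (E_mono h0 h1 fun ω' => split_ind _ u n (bd ω ω') hu).trans ?_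
      rw [E_add, E_const, E_mul]
  refine (E_mono h0 h1 key).trans ?_
  rw [E_mul]
  apply mul_le_mul_of_nonneg_left _ n0
  refine le_trans ?_ (R_main hP H hg hg1 b)
  refine E_mono h0 h1 fun ω => E_mono h0 h1 fun ω' => ind_mono fun h => ?_
  refine lt_of_le_of_lt hgu ?_
  exact pow_lt_pow_left₀ h hu.le two_ne_zero

noncomputable def PS (S : β → Bool) (Y : Matrix (β × γ) (β × γ) ℝ) : Matrix (β × γ) (β × γ) ℝ :=
  diagonal (fun k => bo (S k.1)) * Y * diagonal (fun k => bo (!S k.1))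

lemma PS_apply (S : β → Bool) (Y : Matrix (β × γ) (β × γ) ℝ) (k l) : PS S Y k l = bo (S k.1) * bo (!S l.1) * Y k l := by
  rw [PS, mul_diagonal, diagonal_mul]; ring

lemma nrm_diag_bo (f : β × γ → Bool) : ‖(diagonal (fun k => bo (f k)) : Matrix (β × γ) (β × γ) ℝ)‖ ≤ 1 := by
  rw [l2_opNorm_diagonal, pi_norm_le_iff_of_nonneg zero_le_one]
  intro k
  unfold bo
  split_ifs <;> norm_num

lemma nrm_PS (S : β → Bool) (Y : Matrix (β × γ) (β × γ) ℝ) : ‖PS S Y‖ ≤ ‖Y‖ := by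
  unfold PS
  refine (l2_opNorm_mul _ _).trans ?_
  have h1 := l2_opNorm_mul (diagonal (fun k : β × γ => bo (S k.1))) Y
  have h2 := nrm_diag_bo (fun k : β × γ => S k.1)
  have h3 := nrm_diag_bo (fun k : β × γ => !S k.1)
  have h4 : ‖diagonal (fun k : β × γ => bo (S k.1)) * Y‖ ≤ ‖Y‖ :=
    h1.trans (by nlinarith [norm_nonneg Y])
  exact (mul_le_mul h4 h3 (norm_nonneg _) (norm_nonneg _)).trans (by simp)

lemma PS_Yf (A : α → β → γ → ℝ) (S : β → Bool) (z z' w w' : α × β × γ → ℝ)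
    (h1 : ∀ i, S i.2.1 = true → z i = w i) (h2 : ∀ i, S i.2.1 = false → z' i = w' i) :
    PS S (Yf A z z') = PS S (Yf A w w') := by
  ext k l
  rw [PS_apply, PS_apply]
  by_cases hk : S k.1
  · by_cases hl : S l.1
    · simp [bo, hl]
    · congr 1
      simp only [Yf, of_apply]
      apply Finset.sum_congr rfl
      intro a _
      rw [h1 _ hk, h2 _ (by simpa using hl)]
  · simp [bo, hk]

lemma decouple0 {ι : Type*} [Fintype ι] [DecidableEq ι] (p : ℝ) (s : ι → Bool) (F : (ι → Bool) → (ι → Bool) → ℝ) :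
    E p (fun ω => E p (fun ω' => F ω ω')) =
    E p (fun ω => E p (fun ω' => E p (fun τ => E p (fun τ' => F (mix s ω τ) (mix s ω' τ'))))) := by
  calc E p (fun ω => E p (fun ω' => F ω ω'))
      = E p (fun ω => E p (fun τ => E p (fun ω' => F (mix s ω τ) ω'))) :=
        (E_mix1 p s (fun ω => E p (fun ω' => F ω ω'))).symm
    _ = E p (fun ω => E p (fun τ => E p (fun ω' => E p (fun τ' => F (mix s ω τ) (mix s ω' τ'))))) := by
        congr 1; funext ω; congr 1; funext τ
        exact (E_mix1 p s (fun ω' => F (mix s ω τ) ω')).symm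
    _ = _ := by
        congr 1; funext ω
        exact E_comm p p (fun τ ω' => E p (fun τ' => F (mix s ω τ) (mix s ω' τ')))

lemma decouple (A : α → β → γ → ℝ) (p q : ℝ) (S : β → Bool) (Φ : Matrix (β × γ) (β × γ) ℝ → ℝ) :
    E p (fun ω => E p (fun ω' => Φ (PS S (Yf A (ze q ω ω') (ze q ω ω'))))) =
    E p (fun ω => E p (fun ω' => E p (fun τ => E p (fun τ' => Φ (PS S (Yf A (ze q ω ω') (ze q τ τ'))))))) := by
  have hh : ∀ ω ω' τ τ' : α × β × γ → Bool,
      PS S (Yf A (ze q (mix (fun i => S i.2.1) ω τ) (mix (fun i => S i.2.1) ω' τ'))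
        (ze q (mix (fun i => S i.2.1) ω τ) (mix (fun i => S i.2.1) ω' τ'))) = PS S (Yf A (ze q ω ω') (ze q τ τ')) := by
    intro ω ω' τ τ'
    apply PS_Yf
    · intro i hi
      simp [ze, mix, hi]
    · intro i hi
      simp [ze, mix, hi]
  have e1 := decouple0 p (fun i : α × β × γ => S i.2.1) (fun ω ω' => Φ (PS S (Yf A (ze q ω ω') (ze q ω ω'))))
  simp only [hh] at e1
  exact e1

def Yne (Y : Matrix (β × γ) (β × γ) ℝ) : Matrix (β × γ) (β × γ) ℝ := of fun k l => if k.1 = l.1 then 0 else Y k l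
def Yeq (Y : Matrix (β × γ) (β × γ) ℝ) : Matrix (β × γ) (β × γ) ℝ := of fun k l => if k.1 = l.1 then Y k l else 0

lemma Yne_E (A : α → β → γ → ℝ) (p q : ℝ) (hpq : p * q = 1) (ω : α × β × γ → Bool) :
    Yne (Yf A (xi q ω) (xi q ω)) = E p (fun ω' => E (1/2) (fun S => (4:ℝ) • PS S (Yf A (ze q ω ω') (ze q ω ω')))) := by
  ext k l
  simp only [E_apply, Matrix.smul_apply, smul_eq_mul, PS_apply]
  by_cases h : k.1 = l.1
  · have : ∀ S : β → Bool, bo (S k.1) * bo (!S l.1) = 0 := by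
      intro S; rw [h]; cases S l.1 <;> simp [bo]
    simp only [this, zero_mul, mul_zero, E_const]
    simp only [Yne, of_apply, h, if_true]
  · have hS : E (1/2) (fun S : β → Bool => bo (S k.1) * bo (!S l.1)) = 1/4 := by
      rw [E_two (1/2) k.1 l.1 h (fun b => bo b) (fun b => bo (!b))]
      simp [bo]; norm_num
    have h2 : ∀ y : ℝ, E (1/2) (fun S : β → Bool => 4 * (bo (S k.1) * bo (!S l.1) * y)) = y := by
      intro y
      have : ∀ S : β → Bool, 4 * (bo (S k.1) * bo (!S l.1) * y) = (4 * y) * (bo (S k.1) * bo (!S l.1)) := fun S => by ring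
      simp only [this]
      rw [E_mul, hS]; ring
    simp only [h2]
    simp only [Yne, of_apply, h, if_false, Yf]
    rw [E_sum]
    apply Finset.sum_congr rfl
    intro a _
    have : ∀ ω', ze q ω ω' (a, k.1, l.2) * A a k.1 l.2 * (ze q ω ω' (a, l.1, k.2) * A a l.1 k.2) =
      (A a k.1 l.2 * A a l.1 k.2) * (ze q ω ω' (a, k.1, l.2) * ze q ω ω' (a, l.1, k.2)) := fun ω' => by ring
    simp only [this]
    rw [E_mul, E_ze2 p q hpq ω _ _ (by
      intro hh; apply h; simp only [Prod.mk.injEq] at hh; exact hh.2.1)]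
    ring

lemma Y_desym {A : α → β → γ → ℝ} {p q M X X3 Y2 n : ℝ} {P : ℕ} (hP : 1 ≤ P)
    (H : Hyp A p q M X X3 Y2 (2*P) n) {g : ℝ} (hg : 0 < g) (hg1 : 2 * (X + M * (2*P)) ≤ g)
    (hg2 : 4 * (X3 * (Y2 + M * (2*P)) + M * (X + M * (2*P)) * (2*P)) ≤ g^2)
    (u : ℝ) (hu : 0 < u) (hMu : 4 * M ≤ u) (hgu : 4 * (8 * (2*P) * g) ≤ u) :
    E p (fun ω => ind (2 * u < ‖Yne (Yf A (xi q ω) (xi q ω))‖)) ≤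
      n^3 * ((24 * n^2 + 4 * n^3) * Real.exp (-(2*P))) := by
  have h0 := H.p0.le
  have h1 := H.p1
  have n0 : 0 ≤ n := by linarith [H.n0]
  have n30 : 0 ≤ n^3 := by positivity
  have q0 : (0:ℝ) ≤ 1/2 := by norm_num
  have q1 : (1/2:ℝ) ≤ 1 := by norm_num
  have bd : ∀ ω ω' S, ‖(4:ℝ) • PS S (Yf A (ze q ω ω') (ze q ω ω'))‖ ≤ n^3 * u := by
    intro ω ω' S
    rw [norm_smul]
    have hent : ∀ k l, (Yf A (ze q ω ω') (ze q ω ω') k l)^2 ≤ (n * M)^2 := by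
      intro k l
      simp only [Yf, of_apply]
      apply sq_le_sq'
      · have : ∀ a, -M ≤ (ze q ω ω' (a, k.1, l.2) * A a k.1 l.2) * (ze q ω ω' (a, l.1, k.2) * A a l.1 k.2) := by
          intro a
          have x1 : (ze q ω ω' (a, k.1, l.2) * A a k.1 l.2)^2 ≤ M := by
            rw [mul_pow]
            exact (mul_le_mul_of_nonneg_right (ze_abs _ _ _ _) (sq_nonneg _)).trans (H.hM _ _ _)
          have x2 : (ze q ω ω' (a, l.1, k.2) * A a l.1 k.2)^2 ≤ M := by
            rw [mul_pow]
            exact (mul_le_mul_of_nonneg_right (ze_abs _ _ _ _) (sq_nonneg _)).trans (H.hM _ _ _)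
          nlinarith [sq_nonneg ((ze q ω ω' (a, k.1, l.2) * A a k.1 l.2) + (ze q ω ω' (a, l.1, k.2) * A a l.1 k.2))]
        calc -(n * M) ≤ -(Fintype.card α * M) := by
              have := mul_le_mul_of_nonneg_right H.ca H.M0.le
              linarith
          _ = ∑ a : α, -M := by simp
          _ ≤ _ := Finset.sum_le_sum fun a _ => this a
      · have : ∀ a, (ze q ω ω' (a, k.1, l.2) * A a k.1 l.2) * (ze q ω ω' (a, l.1, k.2) * A a l.1 k.2) ≤ M := by
          intro a
          have x1 : (ze q ω ω' (a, k.1, l.2) * A a k.1 l.2)^2 ≤ M := by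
            rw [mul_pow]
            exact (mul_le_mul_of_nonneg_right (ze_abs _ _ _ _) (sq_nonneg _)).trans (H.hM _ _ _)
          have x2 : (ze q ω ω' (a, l.1, k.2) * A a l.1 k.2)^2 ≤ M := by
            rw [mul_pow]
            exact (mul_le_mul_of_nonneg_right (ze_abs _ _ _ _) (sq_nonneg _)).trans (H.hM _ _ _)
          nlinarith [sq_nonneg ((ze q ω ω' (a, k.1, l.2) * A a k.1 l.2) - (ze q ω ω' (a, l.1, k.2) * A a l.1 k.2))]
        calc _ ≤ ∑ a : α, M := Finset.sum_le_sum fun a _ => this a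
          _ = Fintype.card α * M := by simp
          _ ≤ n * M := mul_le_mul_of_nonneg_right H.ca H.M0.le
    have hcard : (Fintype.card (β × γ) : ℝ) ≤ n^2 := by
      rw [Fintype.card_prod, pow_two]; push_cast
      have := H.cb
      have := H.cc
      gcongr
    have hY := nrm_entry (Yf A (ze q ω ω') (ze q ω ω')) (n * M) (mul_nonneg n0 H.M0.le) hent (n^2) (by positivity)
      (by rw [pow_two (n^2)]; gcongr)
    have hp := nrm_PS S (Yf A (ze q ω ω') (ze q ω ω'))
    have h4 : ‖(4:ℝ)‖ = 4 := by norm_num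
    rw [h4]
    have := mul_le_mul_of_nonneg_left hMu n30
    nlinarith
  let t : (α × β × γ → Bool) → (α × β × γ → Bool) → (β → Bool) → ℝ := fun ω ω' S =>
    ind (u < ‖(4:ℝ) • PS S (Yf A (ze q ω ω') (ze q ω ω'))‖)
  have key : ∀ ω, ind (2 * u < ‖Yne (Yf A (xi q ω) (xi q ω))‖) ≤ n^3 * E p (fun ω' => E (1/2) (fun S => t ω ω' S)) := by
    intro ω
    apply markov _ _ _ _ hu
    · exact mul_nonneg n30 (E_nonneg h0 h1 fun _ => E_nonneg q0 q1 fun _ => ind_nonneg _)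
    · rw [Yne_E A p q H.pq]
      refine (norm_E_le h0 h1 _).trans ?_
      refine (E_mono h0 h1 fun ω' => norm_E_le q0 q1 _).trans ?_
      refine (E_mono h0 h1 fun ω' => E_mono q0 q1 fun S => split_ind _ u (n^3) (bd ω ω' S) hu).trans ?_
      simp only [E_add, E_const, E_mul]
      exact le_rfl
  refine (E_mono h0 h1 key).trans ?_
  rw [E_mul]
  apply mul_le_mul_of_nonneg_left _ n30
  have e1 : E p (fun ω => E p (fun ω' => E (1/2) (fun S => t ω ω' S))) =
      E (1/2) (fun S => E p (fun ω => E p (fun ω' => t ω ω' S))) := by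
    rw [E_comm (1/2) p]
    congr 1; funext ω
    rw [E_comm]
  rw [e1]
  apply E_le_const q0 q1
  intro S
  have e2 := decouple A p q S (fun Z => ind (u < ‖(4:ℝ) • Z‖))
  refine (le_of_eq e2).trans ?_
  refine le_trans ?_ (Y_main hP H hg hg1 hg2)
  refine E_mono h0 h1 fun ω => E_mono h0 h1 fun ω' => E_mono h0 h1 fun τ => E_mono h0 h1 fun τ' => ind_mono fun h => ?_
  rw [norm_smul] at h
  have h4 : ‖(4:ℝ)‖ = 4 := by norm_num
  rw [h4] at h
  have := nrm_PS S (Yf A (ze q ω ω') (ze q τ τ'))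
  linarith

lemma nrm_Yeq (A : α → β → γ → ℝ) (z : α × β × γ → ℝ) (t : ℝ) (ht : 0 ≤ t) (h : ∀ b, ‖Rm A z b‖^2 ≤ t) :
    ‖Yeq (Yf A z z)‖ ≤ t := by
  apply nrm_le _ _ ht
  intro y
  have e : ∀ b c, (Yeq (Yf A z z) *ᵥ y) (b, c) = (((Rm A z b)ᵀ * Rm A z b) *ᵥ (fun c => y (b, c))) c := by
    intro b c
    simp only [mulVec, dotProduct, Fintype.sum_prod_type, Yeq, of_apply]
    rw [Fintype.sum_eq_single b]
    · apply Finset.sum_congr rfl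
      intro c' _
      simp only [if_true, Yf, of_apply, Rm, mul_apply, transpose_apply]
      congr 1
      exact Finset.sum_congr rfl fun a _ => by ring
    · intro b' hb'
      simp [hb'.symm]
  have e1 : (Yeq (Yf A z z) *ᵥ y) ⬝ᵥ (Yeq (Yf A z z) *ᵥ y) = ∑ b,
      (((Rm A z b)ᵀ * Rm A z b) *ᵥ (fun c => y (b, c))) ⬝ᵥ (((Rm A z b)ᵀ * Rm A z b) *ᵥ (fun c => y (b, c))) := by
    simp only [dotProduct, Fintype.sum_prod_type, e]
  have e2 : y ⬝ᵥ y = ∑ b, (fun c => y (b, c)) ⬝ᵥ (fun c => y (b, c)) := by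
    simp only [dotProduct, Fintype.sum_prod_type]
  rw [e1, e2, Finset.mul_sum]
  apply Finset.sum_le_sum
  intro b _
  refine (le_nrm _ _).trans ?_
  apply mul_le_mul_of_nonneg_right _ (Finset.sum_nonneg fun _ _ => mul_self_nonneg _)
  apply pow_le_pow_left₀ (norm_nonneg _)
  refine (l2_opNorm_mul _ _).trans ?_
  rw [nrm_transpose, ← sq]
  exact h b

lemma total {A : α → β → γ → ℝ} {p q M X X3 Y2 n : ℝ} {P : ℕ} (hP : 1 ≤ P)
    (H : Hyp A p q M X X3 Y2 (2*P) n) {g : ℝ} (hg : 0 < g) (hg1 : 2 * (X + M * (2*P)) ≤ g)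
    (hg2 : 4 * (X3 * (Y2 + M * (2*P)) + M * (X + M * (2*P)) * (2*P)) ≤ g^2)
    (u0 : ℝ) (hu : 0 < u0) (hMu : 16 * M ≤ u0) (hgu : 16 * (8 * (2*P) * g) ≤ u0) :
    E p (fun ω => ind (u0 < ‖Yf A (xi q ω) (xi q ω)‖)) ≤ 19 * n^6 * Real.exp (-(2*P)) := by
  have h0 := H.p0.le
  have h1 := H.p1
  have n2 := H.n0
  have n0 : 0 ≤ n := by linarith [H.n0]
  have hδ := (Real.exp_pos (-(2*P : ℝ))).le
  set δ := Real.exp (-(2*P : ℝ))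
  have hu' : 0 < Real.sqrt (u0/8) := Real.sqrt_pos.2 (by positivity)
  have hsq : Real.sqrt (u0/8)^2 = u0/8 := Real.sq_sqrt (by positivity)
  have hPp : (0:ℝ) < P := by exact_mod_cast hP
  have pg : 0 < 8 * (2*P) * g := by positivity
  have M0 := H.M0
  have t1 := Y_desym hP H hg hg1 hg2 (u0/4) (by positivity) (by linarith) (by linarith)
  have t2 := fun b => R_desym hP H hg hg1 (Real.sqrt (u0/8)) hu' (by rw [hsq]; linarith) (by rw [hsq]; linarith) b
  have t3 := sum_ind_le h0 h1 (fun b ω => 2 * Real.sqrt (u0/8) < ‖Rm A (xi q ω) b‖) _ t2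
  have key : ∀ ω, ind (u0 < ‖Yf A (xi q ω) (xi q ω)‖) ≤ ind (2 * (u0/4) < ‖Yne (Yf A (xi q ω) (xi q ω))‖) +
      ind (∃ b, 2 * Real.sqrt (u0/8) < ‖Rm A (xi q ω) b‖) := by
    intro ω
    refine le_trans (ind_mono fun h => ?_) (ind_or _ _)
    by_contra hc
    push Not at hc
    obtain ⟨c1, c2⟩ := hc
    have c3 := nrm_Yeq A (xi q ω) (u0/2) (by positivity) (fun b => by
      have := pow_le_pow_left₀ (norm_nonneg _) (c2 b) 2
      rw [mul_pow, hsq] at this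
      linarith)
    have e : Yf A (xi q ω) (xi q ω) = Yeq (Yf A (xi q ω) (xi q ω)) + Yne (Yf A (xi q ω) (xi q ω)) := by
      ext k l
      simp only [Yeq, Yne, Matrix.add_apply, of_apply]
      split_ifs <;> simp
    have := norm_add_le (Yeq (Yf A (xi q ω) (xi q ω))) (Yne (Yf A (xi q ω) (xi q ω)))
    rw [← e] at this
    linarith
  refine (E_mono h0 h1 key).trans ?_
  rw [E_add]
  have t4 : (Fintype.card β : ℝ) * (n * ((8 * n^2 + 2 * n) * δ)) ≤ n * (n * ((8 * n^2 + 2 * n) * δ)) :=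
    mul_le_mul_of_nonneg_right H.cb (by positivity)
  have t5 : n^3 * (24 * n^2 + 4 * n^3) + n * (n * (8 * n^2 + 2 * n)) ≤ 19 * n^6 := by
    have a1 : 2 * n^5 ≤ n^6 := by nlinarith [pow_nonneg n0 5]
    have a2 : 2 * n^3 ≤ n^4 := by nlinarith [pow_nonneg n0 3]
    have a3 : 2 * n^4 ≤ n^5 := by nlinarith [pow_nonneg n0 4]
    nlinarith
  have := mul_le_mul_of_nonneg_right t5 hδ
  linarith

end Dec
end TC


namespace TC
open Matrix
open scoped Matrix.Norms.L2Operator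

lemma bern_prob {p : ℝ} (h1 : p ≤ 1) : IsProbabilityMeasure (bern (ENNReal.ofReal p)) := by
  constructor
  simp only [bern, Measure.add_apply, Measure.smul_apply, measure_univ, smul_eq_mul, mul_one]
  apply add_tsub_cancel_of_le
  rw [← ENNReal.ofReal_one]
  exact ENNReal.ofReal_le_ofReal h1

lemma bern_single {p : ℝ} (h0 : 0 ≤ p) (b : Bool) :
    bern (ENNReal.ofReal p) {b} = ENNReal.ofReal (if b then p else 1 - p) := by
  cases b
  · simp [bern, ENNReal.ofReal_sub _ h0]
  · simp [bern]

lemma pi_eq {ι : Type*} [Fintype ι] [DecidableEq ι] {p : ℝ} (h0 : 0 ≤ p) (h1 : p ≤ 1) (S : Set (ι → Bool)) :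
    (Measure.pi fun _ : ι => bern (ENNReal.ofReal p)) S = ENNReal.ofReal (E p (fun ω => ind (ω ∈ S))) := by
  classical
  haveI := bern_prob h1
  have e1 : S = ((Finset.univ.filter (fun ω => ω ∈ S) : Finset (ι → Bool)) : Set (ι → Bool)) := by ext; simp
  conv_lhs => rw [e1]
  rw [← MeasureTheory.sum_measure_singleton]
  simp only [E, smul_eq_mul, ind, mul_ite, mul_one, mul_zero]
  rw [← Finset.sum_filter, ENNReal.ofReal_sum_of_nonneg (fun ω _ => wt_nonneg h0 h1 ω)]
  apply Finset.sum_congr rfl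
  intro ω _
  rw [Measure.pi_singleton, wt, ENNReal.ofReal_prod_of_nonneg (fun i _ => by split_ifs <;> linarith)]
  exact Finset.prod_congr rfl fun i _ => bern_single h0 _

lemma arith {n1 n2 n3 n r μ B C m L : ℝ} (p1 : 0 < n1) (p2 : 0 < n2) (p3 : 0 < n3)
    (pr : 0 < r) (pμ : 0 < μ) (pB : 0 < B) (pC : 1 ≤ C) (pm : 0 < m) (pL : 1 ≤ L)
    (l3 : n3 ≤ n)
    (F1 : L * C * n * r * μ^2 ≤ (1/2000) * m)
    (F2 : L^2 * C^2 * r^2 * (n1 * n2 * n3) * μ^3 ≤ (1/2000)^2 * m^2) :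
    ∃ u0 M X X3 Y2 g : ℝ, u0 = B * (n1 * n2 * n3) / (C * r * μ^3) ∧
      M = (n1 * n2 * n3 / m)^2 * (B * r) ∧ X = 2 * (n1 * n2 * n3 / m) * (n * (B / μ)) ∧
      X3 = 2 * (n1 * n2 * n3 / m) * (n3 * (B / μ)) ∧ Y2 = 2 * (n1 * n2 * n3 / m) * (n1 * n2 * (B / μ^2)) ∧
      0 < u0 ∧ 0 < M ∧ 0 < X ∧ 0 ≤ X3 ∧ 0 < g ∧
      2 * (X + M * L) ≤ g ∧ 4 * (X3 * (Y2 + M * L) + M * (X + M * L) * L) ≤ g^2 ∧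
      16 * M ≤ u0 ∧ 16 * (8 * L * g) ≤ u0 := by
  have pC0 : 0 < C := by linarith
  have pL0 : 0 < L := by linarith
  have pn : 0 < n := by linarith
  refine ⟨B * (n1 * n2 * n3) / (C * r * μ^3), (n1 * n2 * n3 / m)^2 * (B * r), 2 * (n1 * n2 * n3 / m) * (n * (B / μ)),
    2 * (n1 * n2 * n3 / m) * (n3 * (B / μ)), 2 * (n1 * n2 * n3 / m) * (n1 * n2 * (B / μ^2)),
    (3/1000) * (B * (n1 * n2 * n3) / (C * r * μ^3)) / L, rfl, rfl, rfl, rfl, rfl,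
    by positivity, by positivity, by positivity, by positivity, by positivity, ?_⟩
  have G1 : (n1 * n2 * n3 / m)^2 * (B * r) * L^2 ≤ (1/2000)^2 * (B * (n1 * n2 * n3) / (C * r * μ^3)) := by
    calc (n1 * n2 * n3 / m)^2 * (B * r) * L^2
        = (B * (n1 * n2 * n3) / (m^2 * C^2 * r * μ^3)) * (L^2 * C^2 * r^2 * (n1 * n2 * n3) * μ^3) := by field_simp
      _ ≤ (B * (n1 * n2 * n3) / (m^2 * C^2 * r * μ^3)) * ((1/2000)^2 * m^2) :=
          mul_le_mul_of_nonneg_left F2 (by positivity)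
      _ = (1/2000)^2 * (B * (n1 * n2 * n3) / (C * r * μ^3)) / C := by field_simp
      _ ≤ _ := div_le_self (by positivity) pC
  have G2 : L * (2 * (n1 * n2 * n3 / m) * (n * (B / μ))) ≤ 2 * (1/2000) * (B * (n1 * n2 * n3) / (C * r * μ^3)) := by
    calc L * (2 * (n1 * n2 * n3 / m) * (n * (B / μ)))
        = (2 * (n1 * n2 * n3) * B / (m * C * r * μ^3)) * (L * C * n * r * μ^2) := by field_simp
      _ ≤ (2 * (n1 * n2 * n3) * B / (m * C * r * μ^3)) * ((1/2000) * m) :=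
          mul_le_mul_of_nonneg_left F1 (by positivity)
      _ = _ := by field_simp
  have G3 : L^2 * ((2 * (n1 * n2 * n3 / m) * (n3 * (B / μ))) * (2 * (n1 * n2 * n3 / m) * (n1 * n2 * (B / μ^2)))) ≤
      4 * (1/2000)^2 * (B * (n1 * n2 * n3) / (C * r * μ^3))^2 := by
    calc _ = (4 * (n1 * n2 * n3)^2 * B^2 / (m^2 * C^2 * r^2 * μ^6)) * (L^2 * C^2 * r^2 * (n1 * n2 * n3) * μ^3) := by
          field_simp; ring
      _ ≤ (4 * (n1 * n2 * n3)^2 * B^2 / (m^2 * C^2 * r^2 * μ^6)) * ((1/2000)^2 * m^2) :=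
          mul_le_mul_of_nonneg_left F2 (by positivity)
      _ = _ := by field_simp; try ring
  have G4 : 2 * (n1 * n2 * n3 / m) * (n3 * (B / μ)) ≤ 2 * (n1 * n2 * n3 / m) * (n * (B / μ)) := by gcongr
  have u0p : 0 < B * (n1 * n2 * n3) / (C * r * μ^3) := by positivity
  have Mp : 0 < (n1 * n2 * n3 / m)^2 * (B * r) := by positivity
  have Xp : 0 < 2 * (n1 * n2 * n3 / m) * (n * (B / μ)) := by positivity
  have X3p : 0 < 2 * (n1 * n2 * n3 / m) * (n3 * (B / μ)) := by positivity
  generalize B * (n1 * n2 * n3) / (C * r * μ^3) = u0 at *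
  generalize (n1 * n2 * n3 / m)^2 * (B * r) = M at *
  generalize 2 * (n1 * n2 * n3 / m) * (n * (B / μ)) = X at *
  generalize 2 * (n1 * n2 * n3 / m) * (n3 * (B / μ)) = X3 at *
  generalize 2 * (n1 * n2 * n3 / m) * (n1 * n2 * (B / μ^2)) = Y2 at *
  have G5 : L * (X + M * L) ≤ 3 * (1/2000) * u0 := by nlinarith
  refine ⟨?_, ?_, ?_, ?_⟩
  · rw [le_div_iff₀ pL0]
    nlinarith
  · have e : ((3/1000) * u0 / L)^2 = 36 * (1/2000)^2 * u0^2 / L^2 := by field_simp; ring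
    rw [e, le_div_iff₀ (by positivity)]
    have H1 : (L * X3) * (M * L^2) ≤ (2 * (1/2000) * u0) * ((1/2000)^2 * u0) :=
      mul_le_mul (le_trans (by gcongr) G2) G1 (by positivity) (by positivity)
    have H2 : (M * L^2) * (L * (X + M * L)) ≤ ((1/2000)^2 * u0) * (3 * (1/2000) * u0) :=
      mul_le_mul G1 G5 (by positivity) (by positivity)
    nlinarith [sq_nonneg u0]
  · have : M * 1 ≤ M * L^2 := mul_le_mul_of_nonneg_left (by nlinarith) Mp.le
    nlinarith
  · have : 8 * L * ((3/1000) * u0 / L) = 8 * ((3/1000) * u0) := by field_simp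
    rw [this]; linarith

end TC


namespace TC
open Matrix
open scoped Matrix.Norms.L2Operator

lemma fin_F {m z β ℓ Q : ℝ} (hz : 0 ≤ z) (hβ : 0 < β) (hℓ : 0 < ℓ)
    (hQ : Q ≤ 10 * ((2 + β) * ℓ)) (hm : 10000 * (2 + β)^2 * ℓ * z < m) :
    Q * z ≤ (1/2000) * m := by
  have a1 : Q * z ≤ 10 * ((2 + β) * ℓ) * z := mul_le_mul_of_nonneg_right hQ hz
  have a2 : 2 * ((2 + β) * (ℓ * z)) ≤ (2 + β) * ((2 + β) * (ℓ * z)) :=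
    mul_le_mul_of_nonneg_right (by linarith) (by positivity)
  linarith

lemma fin_tail {n β Q : ℝ} (hn2 : 2 ≤ n) (hβ : 0 < β) (h : 8 * (2 + β) * Real.log n ≤ Q) :
    19 * n^6 * Real.exp (-Q) < 4 * n ^ (-(β + 1)) := by
  have pn : 0 < n := by linarith
  have d1 : Real.exp (-Q) ≤ n ^ (-(8 * (2 + β))) := by
    rw [Real.rpow_def_of_pos pn]
    apply Real.exp_le_exp.2
    linarith
  have d2 : 19 * n^6 ≤ n ^ (11:ℝ) := by
    have : n ^ (11:ℝ) = n^11 := by rw [← Real.rpow_natCast]; norm_num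
    rw [this]
    have : (2:ℝ)^5 ≤ n^5 := pow_le_pow_left₀ (by norm_num) hn2 5
    have : n^11 = n^5 * n^6 := by ring
    rw [this]
    apply mul_le_mul_of_nonneg_right (by linarith) (by positivity)
  calc 19 * n^6 * Real.exp (-Q) ≤ n ^ (11:ℝ) * n ^ (-(8 * (2 + β))) :=
        mul_le_mul d2 d1 (Real.exp_pos _).le (Real.rpow_pos_of_pos pn _).le
    _ = n ^ ((11:ℝ) + -(8 * (2 + β))) := (Real.rpow_add pn _ _).symm
    _ ≤ n ^ (-(β + 1)) := Real.rpow_le_rpow_of_exponent_le (by linarith) (by linarith)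
    _ < 4 * n ^ (-(β + 1)) := by
        have := Real.rpow_pos_of_pos pn (-(β + 1))
        linarith

set_option maxHeartbeats 2000000 in
lemma final (n₁ n₂ n₃ : ℕ) (h₁ : 2 ≤ n₁) (h₂ : 2 ≤ n₂) (h₃ : 2 ≤ n₃)
    (r : ℕ) (hr : 1 ≤ r) (μ B C β m : ℝ)
    (hμ : 1 ≤ μ) (hB : 0 < B) (hC : 1 ≤ C) (hβ : 0 < β)
    (hm1 : 10000 * C * (2 + β) ^ 2 * ((max (max n₁ n₂) n₃ : ℕ) : ℝ) * r * μ ^ 2 *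
        Real.log ((max (max n₁ n₂) n₃ : ℕ) : ℝ) < m)
    (hm2 : 10000 * C * (2 + β) ^ 2 * r * Real.sqrt n₁ * ((max n₂ n₃ : ℕ) : ℝ) *
        μ ^ ((3 : ℝ) / 2) * Real.log ((max (max n₁ n₂) n₃ : ℕ) : ℝ) < m)
    (hm3 : m ≤ (n₁ * n₂ * n₃ : ℝ))
    (A : Fin n₁ → Fin n₂ → Fin n₃ → ℝ) (hA : IsBdd n₁ n₂ n₃ A B r μ) :
    0 ≤ m / (n₁ * n₂ * n₃) ∧ m / (n₁ * n₂ * n₃) ≤ 1 ∧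
    E (m / (n₁ * n₂ * n₃)) (fun ω => ind (B * (n₁ * n₂ * n₃ : ℝ) / (C * r * μ ^ 3) <
      ‖Yf A (xi ((n₁ * n₂ * n₃ : ℝ) / m) ω) (xi ((n₁ * n₂ * n₃ : ℝ) / m) ω)‖)) <
       4 * ((max (max n₁ n₂) n₃ : ℕ) : ℝ) ^ (-(β + 1)) := by
  have p1 : (0:ℝ) < n₁ := by exact_mod_cast (by omega : 0 < n₁)
  have p2 : (0:ℝ) < n₂ := by exact_mod_cast (by omega : 0 < n₂)
  have p3 : (0:ℝ) < n₃ := by exact_mod_cast (by omega : 0 < n₃)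
  have pr1 : (1:ℝ) ≤ r := by exact_mod_cast hr
  have pr : (0:ℝ) < r := by linarith
  have l1 : (n₁:ℝ) ≤ ((max (max n₁ n₂) n₃ : ℕ) : ℝ) := by exact_mod_cast (by omega)
  have l2 : (n₂:ℝ) ≤ ((max (max n₁ n₂) n₃ : ℕ) : ℝ) := by exact_mod_cast (by omega)
  have l3 : (n₃:ℝ) ≤ ((max (max n₁ n₂) n₃ : ℕ) : ℝ) := by exact_mod_cast (by omega)
  have k2 : (n₂:ℝ) ≤ ((max n₂ n₃ : ℕ) : ℝ) := by exact_mod_cast (by omega)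
  have k3 : (n₃:ℝ) ≤ ((max n₂ n₃ : ℕ) : ℝ) := by exact_mod_cast (by omega)
  have hn2 : (2:ℝ) ≤ ((max (max n₁ n₂) n₃ : ℕ) : ℝ) := by exact_mod_cast (by omega)
  generalize ((max (max n₁ n₂) n₃ : ℕ) : ℝ) = n at *
  generalize ((max n₂ n₃ : ℕ) : ℝ) = k at *
  have pn : 0 < n := by linarith
  have pk : 0 < k := by linarith
  have pμ : 0 < μ := by linarith
  have pC : 0 < C := by linarith
  have hln : 0.69 < Real.log n := by
    have := Real.log_le_log (by norm_num : (0:ℝ) < 2) hn2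
    have := Real.log_two_gt_d9
    linarith
  set ℓ := Real.log n with hℓ
  have pℓ : 0 < ℓ := by linarith
  have hbl : 1 ≤ (2 + β) * ℓ := by nlinarith
  have pm : 0 < m := lt_of_le_of_lt (by positivity) hm1
  have pN : (0:ℝ) < n₁ * n₂ * n₃ := by positivity
  obtain ⟨P, hP⟩ : ∃ P, P = ⌈4 * ((2 + β) * ℓ)⌉₊ := ⟨_, rfl⟩
  have hPl : 4 * ((2 + β) * ℓ) ≤ P := by rw [hP]; exact Nat.le_ceil _
  have hPu : (P:ℝ) ≤ 5 * ((2 + β) * ℓ) := by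
    have := Nat.ceil_lt_add_one (by positivity : 0 ≤ 4 * ((2 + β) * ℓ))
    rw [← hP] at this
    linarith
  have hP1 : 1 ≤ P := by
    have : (1:ℝ) ≤ P := by linarith
    exact_mod_cast this
  have hL1 : (1:ℝ) ≤ 2 * P := by linarith
  have hLu : (2 * P : ℝ) ≤ 10 * ((2 + β) * ℓ) := by linarith
  have F1 : (2 * P : ℝ) * C * n * r * μ^2 ≤ (1/2000) * m := by
    have := fin_F (z := C * n * r * μ^2) (m := m) (by positivity) hβ pℓ hLu
      (lt_of_eq_of_lt (by ring) hm1)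
    refine le_of_eq_of_le (by ring) this
  have F2a : (2 * P : ℝ) * C * r * Real.sqrt n₁ * k * μ ^ ((3:ℝ)/2) ≤ (1/2000) * m := by
    have pw : 0 < μ ^ ((3:ℝ)/2) := Real.rpow_pos_of_pos pμ _
    have := fin_F (z := C * r * Real.sqrt n₁ * k * μ ^ ((3:ℝ)/2)) (m := m) (by positivity) hβ pℓ hLu
      (lt_of_eq_of_lt (by ring) hm2)
    refine le_of_eq_of_le (by ring) this
  have F2 : (2 * P : ℝ)^2 * C^2 * (r:ℝ)^2 * (n₁ * n₂ * n₃) * μ^3 ≤ (1/2000)^2 * m^2 := by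
    have pw : 0 < μ ^ ((3:ℝ)/2) := Real.rpow_pos_of_pos pμ _
    have a := pow_le_pow_left₀ (by positivity) F2a 2
    have e1 : (μ ^ ((3:ℝ)/2))^2 = μ^3 := by
      rw [← Real.rpow_natCast, ← Real.rpow_mul pμ.le, ← Real.rpow_natCast]
      norm_num
    have e2 : Real.sqrt n₁ ^ 2 = n₁ := Real.sq_sqrt p1.le
    simp only [mul_pow _ _ 2, e1, e2] at a
    have a2 : (n₂:ℝ) * n₃ ≤ k^2 := by rw [pow_two]; gcongr
    have a3 : ((2 * P : ℝ)^2 * C^2 * (r:ℝ)^2 * n₁ * μ^3) * (n₂ * n₃) ≤ ((2 * P : ℝ)^2 * C^2 * (r:ℝ)^2 * n₁ * μ^3) * k^2 := by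
      gcongr
    simp only [mul_pow _ _ 2] at a3 ⊢
    linarith
  obtain ⟨u0, M, X, X3, Y2, g, e1, e2, e3, e4, e5, q1, q2, q3, q4, q5, q6, q7, q8, q9⟩ :=
    arith p1 p2 p3 pr pμ hB hC pm hL1 l3 F1 F2
  have hp1 : m / (n₁ * n₂ * n₃ : ℝ) ≤ 1 := (div_le_one pN).2 hm3
  have hp0 : 0 < m / (n₁ * n₂ * n₃ : ℝ) := by positivity
  obtain ⟨A1, A2, A3, A4, A5, A6, A7, A8⟩ := hA
  have cv : ∀ (s t w : ℝ), 0 < s → (1 / s) * t ≤ w → t ≤ s * w := by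
    intro s t w hs h
    rw [one_div, inv_mul_le_iff₀ hs] at h
    exact h
  have q0 : 0 < (n₁ * n₂ * n₃ : ℝ) / m := by positivity
  have H : Hyp A (m / (n₁ * n₂ * n₃)) ((n₁ * n₂ * n₃ : ℝ) / m) M X X3 Y2 (2 * P) n := by
    refine ⟨hp0, hp1, by field_simp, q2, q3, q4, by linarith, ?_, ?_, ?_, ?_, ?_, ?_, hn2, ?_, ?_, ?_⟩
    · intro a b c
      rw [e2]
      exact mul_le_mul_of_nonneg_left (A1 a b c) (by positivity)
    · intro a b
      rw [e3]
      apply mul_le_mul_of_nonneg_left _ (by positivity)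
      exact (cv _ _ _ p3 (A4 a b)).trans (by gcongr)
    · intro a b
      rw [e4]
      apply mul_le_mul_of_nonneg_left _ (by positivity)
      exact (cv _ _ _ p3 (A4 a b))
    · intro a b
      rw [e3]
      apply mul_le_mul_of_nonneg_left _ (by positivity)
      exact (cv _ _ _ p2 (A3 a b)).trans (by gcongr)
    · intro a b
      rw [e3]
      apply mul_le_mul_of_nonneg_left _ (by positivity)
      exact (cv _ _ _ p1 (A2 a b)).trans (by gcongr)
    · intro c
      rw [e5]
      apply mul_le_mul_of_nonneg_left _ (by positivity)
      exact (cv _ _ _ (by positivity) (A5 c))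
    · simpa using l1
    · simpa using l2
    · simpa using l3
  have T := total hP1 H q5 q6 q7 u0 q1 q8 q9
  refine ⟨hp0.le, hp1, ?_⟩
  rw [← e1]
  refine lt_of_le_of_lt T ?_
  exact fin_tail hn2 hβ (by linarith)

end TC

theorem stmt_18 (n₁ n₂ n₃ : ℕ) (h₁ : 2 ≤ n₁) (h₂ : 2 ≤ n₂) (h₃ : 2 ≤ n₃)
    (r : ℕ) (hr : 1 ≤ r) (μ B C β m : ℝ)
    (hμ : 1 ≤ μ) (hB : 0 < B) (hC : 1 ≤ C) (hβ : 0 < β)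
    (hrμ : μ * r ≤ ((min (min n₁ n₂) n₃ : ℕ) : ℝ))
    (hm1 : 10000 * C * (2 + β) ^ 2 * ((max (max n₁ n₂) n₃ : ℕ) : ℝ) * r * μ ^ 2 *
        Real.log ((max (max n₁ n₂) n₃ : ℕ) : ℝ) < m)
    (hm2 : 10000 * C * (2 + β) ^ 2 * r * Real.sqrt n₁ * ((max n₂ n₃ : ℕ) : ℝ) *
        μ ^ ((3 : ℝ) / 2) * Real.log ((max (max n₁ n₂) n₃ : ℕ) : ℝ) < m)
    (hm3 : m ≤ (n₁ * n₂ * n₃ : ℝ))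
    (A : Fin n₁ → Fin n₂ → Fin n₃ → ℝ) (hA : IsBdd n₁ n₂ n₃ A B r μ) :
    (Measure.pi fun _ : Fin n₁ × Fin n₂ × Fin n₃ =>
        bern (ENNReal.ofReal (m / (n₁ * n₂ * n₃))))
      {ω : Fin n₁ × Fin n₂ × Fin n₃ → Bool |
        B * (n₁ * n₂ * n₃ : ℝ) / (C * r * μ ^ 3) <
          specNorm (Matrix.of fun (p q : Fin n₂ × Fin n₃) =>
            ∑ a, ((if ω (a, p.1, q.2) then (n₁ * n₂ * n₃ : ℝ) / m - 1 else -1) *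
                    A a p.1 q.2) *
                 ((if ω (a, q.1, p.2) then (n₁ * n₂ * n₃ : ℝ) / m - 1 else -1) *
                    A a q.1 p.2))}
      < ENNReal.ofReal (4 * ((max (max n₁ n₂) n₃ : ℕ) : ℝ) ^ (-(β + 1))) := by
  obtain ⟨hp0, hp1, hE⟩ := TC.final n₁ n₂ n₃ h₁ h₂ h₃ r hr μ B C β m hμ hB hC hβ hm1 hm2 hm3 A hA
  rw [TC.pi_eq hp0 hp1]
  have hn : (0:ℝ) < ((max (max n₁ n₂) n₃ : ℕ) : ℝ) := by exact_mod_cast (by omega)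
  refine (ENNReal.ofReal_lt_ofReal_iff (by have := Real.rpow_pos_of_pos hn (-(β + 1)); linarith)).2 ?_
  refine lt_of_le_of_lt (le_of_eq ?_) hE
  congr 1
  funext ω
  congr 1
  rw [Set.mem_ofPred_eq, Matrix.l2_opNorm_def]
  have e : ∀ i, TC.xi ((n₁ * n₂ * n₃ : ℝ) / m) ω i = if ω i then (n₁ * n₂ * n₃ : ℝ) / m - 1 else -1 := by
    intro i
    unfold TC.xi TC.bo
    split_ifs <;> simp
  simp only [TC.Yf, e, specNorm]
  rfl
end
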